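/- Dilation lemma on failure of total equidistribution (torus case of [lmr, Lemma 16.3], as used in the proof of Theorem 2.3): For all positive integers m, d there is a constant C' = C'(m,d) ≥ 1 with the following property. Let δ ∈ (0,1), let q ≥ 1 be an integer, let g : ℤ → 𝕋^m be a polynomial sequence of degree ≤ d, and suppose N is sufficiently large in terms of δ, q, m and d. If the finite sequence (g(q·n))_{n ≤ N/q} fails to be totally δ-equidistributed in 𝕋^m, then for every integer r with 0 ≤ r < q^d the finite sequence (g(q^d·n + r))_{n ≤ N/q^d} fails to be totally δ^{C'}-equidistributed in 𝕋^m. -/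

import Mathlib

open MeasureTheory

noncomputable section

instance : Fact ((0:ℝ) < 1) := ⟨one_pos⟩

/-- The `m`-dimensional torus `(ℝ/ℤ)^m`. -/
abbrev Torus (m : ℕ) := Fin m → AddCircle (1:ℝ)

/-- The Lipschitz norm of `F : 𝕋^m → ℝ`: sup-norm plus the best Lipschitz constant. -/
def lipNorm {m : ℕ} (F : Torus m → ℝ) : ℝ :=
  (⨆ x, |F x|) + sInf {L : ℝ | 0 ≤ L ∧ LipschitzWith (Real.toNNReal L) F}

/-- `g : ℤ → 𝕋^m` is a polynomial sequence of degree at most `d`. -/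
def IsPolySeq (m d : ℕ) (g : ℤ → Torus m) : Prop :=
  ∃ P : Fin m → Polynomial ℝ, (∀ i, (P i).degree ≤ (d : ℕ)) ∧
    ∀ n : ℤ, g n = fun i => (((P i).eval (n : ℝ) : ℝ) : AddCircle (1:ℝ))

/-- `(u(n))_{n ≤ N}` is totally `δ`-equidistributed in `𝕋^m`: for every arithmetic
progression `P ⊆ {1,…,N}` of cardinality at least `δ·N` and every Lipschitz `F` the sum of
`F ∘ u` over `P` is within `δ·‖F‖_Lip·|P|` of `|P|·∫ F dμ`. -/
def TotallyEquidistributed (m N : ℕ) (δ : ℝ) (u : ℕ → Torus m) : Prop :=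
  ∀ a d len : ℕ, 0 < d → 0 < len →
    (∀ n < len, 1 ≤ a + n * d ∧ a + n * d ≤ N) →
    δ * N ≤ len →
    ∀ (F : Torus m → ℝ) (L : NNReal), LipschitzWith L F →
      |(∑ n ∈ Finset.range len, F (u (a + n * d))) - len * ∫ x, F x| ≤
        δ * lipNorm F * len

section DilationHelpers

open Finset Polynomial

def ee (x : ℝ) : ℂ := Complex.exp (((2 * Real.pi * x : ℝ) : ℂ) * Complex.I)

abbrev nn (x : ℝ) : ℝ := ‖(x : AddCircle (1:ℝ))‖

lemma ee_add (x y : ℝ) : ee (x + y) = ee x * ee y := by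
  unfold ee; rw [← Complex.exp_add]; congr 1; push_cast; ring

lemma ee_zero : ee 0 = 1 := by simp [ee]

lemma norm_ee (x : ℝ) : ‖ee x‖ = 1 := by
  unfold ee; exact Complex.norm_exp_ofReal_mul_I _

lemma ee_int (z : ℤ) : ee z = 1 := by
  unfold ee; rw [Complex.exp_eq_one_iff]; refine ⟨z, ?_⟩; push_cast; ring

lemma ee_neg (x : ℝ) : ee (-x) = (starRingEnd ℂ) (ee x) := by
  unfold ee; rw [← Complex.exp_conj]; congr 1
  rw [map_mul, Complex.conj_ofReal, Complex.conj_I]; push_cast; ring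

lemma ee_sub (x y : ℝ) : ee (x - y) = ee x * (starRingEnd ℂ) (ee y) := by
  rw [sub_eq_add_neg, ee_add, ee_neg]

lemma nn_eq (x : ℝ) : nn x = |x - round x| := UnitAddCircle.norm_eq

lemma nn_nonneg (x : ℝ) : 0 ≤ nn x := norm_nonneg _

lemma nn_le_half (x : ℝ) : nn x ≤ 1 / 2 := by
  rw [nn_eq]; exact abs_sub_round x

lemma nn_exists (x : ℝ) : ∃ z : ℤ, |x - z| = nn x := ⟨round x, (nn_eq x).symm⟩

lemma nn_le_abs_sub (x : ℝ) (z : ℤ) : nn x ≤ |x - z| := by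
  rw [nn_eq]; exact round_le x z

lemma nn_le_abs (x : ℝ) : nn x ≤ |x| := by simpa using nn_le_abs_sub x 0

lemma nn_add_le (x y : ℝ) : nn (x + y) ≤ nn x + nn y := by
  exact norm_add_le (x : AddCircle (1:ℝ)) (y : AddCircle (1:ℝ))

lemma nn_sub_le (x y : ℝ) : nn (x - y) ≤ nn x + nn y := by
  exact norm_sub_le (x : AddCircle (1:ℝ)) (y : AddCircle (1:ℝ))

lemma nn_int_mul (z : ℤ) (x : ℝ) : nn (z * x) ≤ |(z:ℝ)| * nn x := by
  obtain ⟨w, hw⟩ := nn_exists x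
  rw [← hw, ← abs_mul]
  refine (nn_le_abs_sub _ (z * w)).trans (le_of_eq ?_)
  push_cast; congr 1; ring

lemma nn_nat_mul (z : ℕ) (x : ℝ) : nn (z * x) ≤ z * nn x := by
  have := nn_int_mul z x
  simpa using this

lemma nn_add_int (x : ℝ) (z : ℤ) : nn (x + z) = nn x := by
  rw [nn_eq, nn_eq, round_add_intCast]; push_cast; congr 1; ring

lemma nn_sum_le {ι : Type*} (s : Finset ι) (f : ι → ℝ) : nn (∑ i ∈ s, f i) ≤ ∑ i ∈ s, nn (f i) := by
  classical
  induction s using Finset.induction_on with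
  | empty => simp [nn]
  | insert a s ha ih =>
    rw [sum_insert ha, sum_insert ha]
    exact (nn_add_le _ _).trans (by linarith)

lemma nn_eq_abs {x : ℝ} (h : |x| ≤ 1 / 2) : nn x = |x| := by
  unfold nn
  rw [AddCircle.norm_coe_eq_abs_iff (1:ℝ) one_ne_zero]; simpa using h

lemma ee_add_int (x : ℝ) (z : ℤ) : ee (x + z) = ee x := by rw [ee_add, ee_int, mul_one]

lemma norm_ee_sub_one (x : ℝ) : ‖ee x - 1‖ = 2 * |Real.sin (Real.pi * x)| := by
  have := Complex.norm_exp_I_mul_ofReal_sub_one (2 * Real.pi * x)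
  unfold ee
  rw [mul_comm, this, norm_mul, Real.norm_eq_abs, Real.norm_eq_abs, abs_two]
  congr 3; ring

lemma four_nn_le (x : ℝ) : 4 * nn x ≤ ‖ee x - 1‖ := by
  have h1 : ee x = ee (x - round x) := by
    have := ee_add_int x (- round x)
    rw [← this]; congr 1; push_cast; ring
  rw [h1, nn_eq, norm_ee_sub_one]
  have h2 := abs_sub_round x
  set y := x - round x
  have h3 := Real.mul_abs_le_abs_sin (x := Real.pi * y) (by
    rw [abs_mul, abs_of_pos Real.pi_pos]; nlinarith [Real.pi_pos])
  rw [abs_mul, abs_of_pos Real.pi_pos] at h3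
  have h4 : 2 / Real.pi * (Real.pi * |y|) = 2 * |y| := by field_simp
  linarith

lemma norm_ee_sub_one_le (x : ℝ) : ‖ee x - 1‖ ≤ 7 * nn x := by
  have h1 : ee x = ee (x - round x) := by
    have := ee_add_int x (- round x)
    rw [← this]; congr 1; push_cast; ring
  rw [h1, nn_eq, norm_ee_sub_one]
  set y := x - round x
  have h3 : |Real.sin (Real.pi * y)| ≤ |Real.pi * y| := Real.abs_sin_le_abs
  rw [abs_mul, abs_of_pos Real.pi_pos] at h3
  nlinarith [Real.pi_lt_d2, abs_nonneg y]

lemma norm_ee_sub_ee_le (x y : ℝ) : ‖ee x - ee y‖ ≤ 7 * nn (x - y) := by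
  have : ee x - ee y = (ee (x - y) - 1) * ee y := by
    rw [sub_mul, ← ee_add]; simp
  rw [this, norm_mul, norm_ee, mul_one]; exact norm_ee_sub_one_le _

/-! polynomially bounded functions -/

def PB (f : ℝ → ℝ) : Prop := ∃ C : ℕ, ∀ B : ℝ, 2 ≤ B → |f B| ≤ B ^ C

lemma PB.id : PB (fun B => B) := ⟨1, fun B hB => by rw [abs_of_nonneg (by linarith)]; simp⟩

lemma PB.const (c : ℝ) : PB (fun _ => c) := by
  obtain ⟨n, hn⟩ := pow_unbounded_of_one_lt |c| (one_lt_two (α := ℝ))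
  exact ⟨n, fun B hB => hn.le.trans (pow_le_pow_left₀ (by norm_num) hB n)⟩

lemma PB.mul {f g : ℝ → ℝ} (hf : PB f) (hg : PB g) : PB (fun B => f B * g B) := by
  obtain ⟨C, hC⟩ := hf
  obtain ⟨D, hD⟩ := hg
  refine ⟨C + D, fun B hB => ?_⟩
  rw [abs_mul, pow_add]
  exact mul_le_mul (hC B hB) (hD B hB) (abs_nonneg _) (by positivity)

lemma PB.add {f g : ℝ → ℝ} (hf : PB f) (hg : PB g) : PB (fun B => f B + g B) := by
  obtain ⟨C, hC⟩ := hf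
  obtain ⟨D, hD⟩ := hg
  refine ⟨C + D + 1, fun B hB => ?_⟩
  have h1 : (1:ℝ) ≤ B := by linarith
  have e1 : B ^ C ≤ B ^ (C + D) := pow_le_pow_right₀ h1 (by omega)
  have e2 : B ^ D ≤ B ^ (C + D) := pow_le_pow_right₀ h1 (by omega)
  have e3 : (0:ℝ) ≤ B ^ (C + D) := by positivity
  calc |f B + g B| ≤ |f B| + |g B| := abs_add_le _ _
    _ ≤ B ^ (C + D) * 2 := by linarith [hC B hB, hD B hB]
    _ ≤ B ^ (C + D) * B := by gcongr
    _ = _ := by rw [pow_succ]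

lemma PB.pow {f : ℝ → ℝ} (hf : PB f) (n : ℕ) : PB (fun B => f B ^ n) := by
  induction n with
  | zero => simpa using PB.const 1
  | succ n ih => simp_rw [pow_succ]; exact ih.mul hf

lemma PB.le {f : ℝ → ℝ} (hf : PB f) : ∃ C : ℕ, ∀ B : ℝ, 2 ≤ B → f B ≤ B ^ C := by
  obtain ⟨C, hC⟩ := hf
  exact ⟨C, fun B hB => (le_abs_self _).trans (hC B hB)⟩

lemma PB.le₂ {f g : ℝ → ℝ} (hf : PB f) (hg : PB g) :
    ∃ C : ℕ, ∀ B : ℝ, 2 ≤ B → f B ≤ B ^ C ∧ g B ≤ B ^ C := by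
  obtain ⟨C, hC⟩ := hf.le
  obtain ⟨D, hD⟩ := hg.le
  refine ⟨C + D, fun B hB => ⟨(hC B hB).trans (pow_le_pow_right₀ (by linarith) (by omega)),
    (hD B hB).trans (pow_le_pow_right₀ (by linarith) (by omega))⟩⟩

/-! shifts -/

lemma shift_one (f : ℕ → ℂ) (hf : ∀ n, ‖f n‖ ≤ 1) (L s : ℕ) :
    ‖∑ n ∈ range L, f (n + s) - ∑ n ∈ range L, f n‖ ≤ 2 * s := by
  have h1 := Finset.sum_range_add f L s
  have h2 := Finset.sum_range_add f s L
  rw [add_comm s L, h1] at h2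
  have h3 : ∑ n ∈ range L, f (n + s) - ∑ n ∈ range L, f n
      = ∑ x ∈ range s, f (L + x) - ∑ x ∈ range s, f x := by
    have : ∑ n ∈ range L, f (n + s) = ∑ n ∈ range L, f (s + n) := by simp_rw [add_comm]
    rw [this]
    linear_combination -h2
  rw [h3]
  have h4 : ∀ g : ℕ → ℂ, (∀ n, ‖g n‖ ≤ 1) → ‖∑ x ∈ range s, g x‖ ≤ s := fun g hg => by
    refine (norm_sum_le _ _).trans ?_
    refine (sum_le_sum fun i _ => hg i).trans ?_
    simp
  have := h4 (fun x => f (L + x)) (fun n => hf _)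
  have := h4 f hf
  refine (norm_sub_le _ _).trans ?_
  linarith

lemma shift_avg (f : ℕ → ℂ) (hf : ∀ n, ‖f n‖ ≤ 1) (L L' k : ℕ) :
    L' * ‖∑ n ∈ range L, f n‖ - 2 * k * L' * L' ≤
      ‖∑ n ∈ range L, ∑ t ∈ range L', f (n + k * t)‖ := by
  rw [sum_comm]
  have h1 : ‖∑ t ∈ range L', ∑ n ∈ range L, f (n + k * t) - L' * ∑ n ∈ range L, f n‖
      ≤ 2 * k * L' * L' := by
    have : (L' : ℂ) * ∑ n ∈ range L, f n = ∑ t ∈ range L', ∑ n ∈ range L, f n := by simp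
    rw [this, ← sum_sub_distrib]
    refine (norm_sum_le _ _).trans ?_
    refine (sum_le_sum (g := fun _ => (2 * k * L' : ℝ)) fun t ht => ?_).trans ?_
    · refine (shift_one f hf L (k * t)).trans ?_
      have : (t:ℝ) ≤ L' := by exact_mod_cast (mem_range.mp ht).le
      push_cast
      have : (k:ℝ) * t ≤ k * L' := by gcongr
      linarith
    · simp; linarith
  have h2 : ‖(L' : ℂ) * ∑ n ∈ range L, f n‖ = L' * ‖∑ n ∈ range L, f n‖ := by simp
  have h3 := norm_sub_norm_le ((L' : ℂ) * ∑ n ∈ range L, f n) (∑ t ∈ range L', ∑ n ∈ range L, f (n + k * t))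
  rw [norm_sub_rev] at h3
  rw [h2] at h3
  linarith

/-! coefficients under affine substitution -/

lemma coeff_affine (p : ℝ[X]) (d : ℕ) (hp : p.natDegree ≤ d) (u v : ℝ) (j : ℕ) :
    (p.comp (C v * X + C u)).coeff j =
      ∑ i ∈ range (d + 1), p.coeff i * (i.choose j * u ^ (i - j) * v ^ j) := by
  have h0 : C v * X + C u = (X + C u).comp (C v * X) := by simp
  rw [h0, ← comp_assoc, comp_C_mul_X_coeff]
  have h1 : p.comp (X + C u) = ∑ i ∈ range (d + 1), C (p.coeff i) * (X + C u) ^ i := by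
    rw [comp, eval₂_eq_sum_range' C (Nat.lt_succ_of_le hp)]
  rw [h1, finsetSum_coeff, sum_mul]
  refine sum_congr rfl fun i _ => ?_
  rw [coeff_C_mul, coeff_X_add_C_pow]; ring

lemma natDegree_affine (p : ℝ[X]) (d : ℕ) (hp : p.natDegree ≤ d) (u v : ℝ) :
    (p.comp (C v * X + C u)).natDegree ≤ d := by
  refine natDegree_comp_le.trans ?_
  have : (C v * X + C u).natDegree ≤ 1 := natDegree_linear_le
  nlinarith

lemma eval_affine (p : ℝ[X]) (u v x : ℝ) :
    (p.comp (C v * X + C u)).eval x = p.eval (v * x + u) := by simp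

lemma spread (s : Finset ℕ) (hs : s.Nonempty) : ∃ x ∈ s, ∃ y ∈ s, x ≤ y ∧ s.card ≤ y - x + 1 := by
  refine ⟨s.min' hs, s.min'_mem hs, s.max' hs, s.max'_mem hs, s.min'_le _ (s.max'_mem hs), ?_⟩
  have : s ⊆ Icc (s.min' hs) (s.max' hs) := fun x hx =>
    mem_Icc.mpr ⟨s.min'_le _ hx, s.le_max' _ hx⟩
  have h := card_le_card this
  rw [Nat.card_Icc] at h
  have := s.min'_le _ (s.max'_mem hs)
  omega

lemma recur (β ε A D : ℝ) (L : ℕ) (S : Finset ℕ) (hS : S ⊆ range L) (hA : 1 ≤ A) (hD : 1 ≤ D)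
    (hε0 : 0 ≤ ε) (hcard : (L:ℝ) ≤ D * S.card)
    (hε : ∀ h ∈ S, ∀ h' ∈ S, nn (β * ((h:ℝ) - h')) ≤ ε) (hεL : ε * L ≤ A)
    (hL : 8 * A + 2 * D * ((4 * A + 1) * (2 * D + 1)) + 4 * D ≤ L) :
    ∃ k : ℕ, 1 ≤ k ∧ (k:ℝ) ≤ 2 * D + 1 ∧
      nn (k * β) ≤ ε * (2 * D + 1) * (2 * D * ((4 * A + 1) * (2 * D + 1))) / L := by
  set Y : ℝ := (4 * A + 1) * (2 * D + 1) with hY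
  have hYpos : 1 ≤ Y := by nlinarith
  have hDY : 0 ≤ D * Y := by positivity
  have hLpos : (0:ℝ) < L := by nlinarith
  set K : ℕ := ⌈2 * D⌉₊ with hK
  have hK1 : 2 * D ≤ K := Nat.le_ceil _
  have hK2 : (K:ℝ) < 2 * D + 1 := Nat.ceil_lt_add_one (by linarith)
  have hKpos : 0 < K := by
    have : (0:ℝ) < K := by linarith
    exact_mod_cast this
  have hScard : (L:ℝ) / D ≤ S.card := by rw [div_le_iff₀ (by linarith)]; linarith
  -- step 1
  have step1 : ∃ x ∈ S, ∃ y ∈ S, x ≠ y ∧ x / K = y / K := by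
    apply exists_ne_map_eq_of_card_lt_of_maps_to (t := range (L / K + 1))
    · rw [card_range]
      have h1 : ((L / K : ℕ) : ℝ) ≤ L / K := Nat.cast_div_le
      have h2 : (L:ℝ) / K ≤ L / (2 * D) := by gcongr
      have h3 : (L:ℝ) / D = L / (2 * D) + L / (2 * D) := by field_simp; norm_num
      have h4 : 2 ≤ (L:ℝ) / (2 * D) := by rw [le_div_iff₀ (by linarith)]; nlinarith
      have : ((L / K + 1 : ℕ) : ℝ) < S.card := by push_cast; linarith
      exact_mod_cast this
    · intro x hx
      have := mem_range.mp (hS hx)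
      simp only [coe_range, Set.mem_Iio]
      have := Nat.div_le_div_right (c := K) this.le
      omega
  obtain ⟨k, hk1, hkK, hk⟩ : ∃ k : ℕ, 1 ≤ k ∧ k ≤ K ∧ nn (k * β) ≤ ε := by
    have key : ∀ x ∈ S, ∀ y ∈ S, x < y → x / K = y / K →
        ∃ k : ℕ, 1 ≤ k ∧ k ≤ K ∧ nn (k * β) ≤ ε := by
      intro x hx y hy hxy he
      refine ⟨y - x, by omega, ?_, ?_⟩
      · have h1 := Nat.div_add_mod x K
        have h2 := Nat.div_add_mod y K
        have h3 := Nat.mod_lt y hKpos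
        rw [he] at h1
        omega
      · have := hε y hy x hx
        rw [Nat.cast_sub hxy.le, mul_comm]; exact this
    obtain ⟨x, hx, y, hy, hne, he⟩ := step1
    rcases lt_or_gt_of_ne hne with h | h
    · exact key x hx y hy h he
    · exact key y hy x hx h he.symm
  have hkR : (k:ℝ) ≤ 2 * D + 1 := by
    have : (k:ℝ) ≤ K := by exact_mod_cast hkK
    linarith
  have hkpos : (1:ℝ) ≤ k := by exact_mod_cast hk1
  refine ⟨k, hk1, hkR, ?_⟩
  obtain ⟨a, ha⟩ := nn_exists (k * β)
  -- windows
  set W : ℕ := ⌊(L:ℝ) / (2 * A)⌋₊ with hW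
  have hW1 : (W:ℝ) ≤ L / (2 * A) := Nat.floor_le (by positivity)
  have hW2 : (L:ℝ) / (4 * A) ≤ W := by
    have h1 : (L:ℝ) / (2 * A) < W + 1 := Nat.lt_floor_add_one _
    have h2 : (L:ℝ) / (2 * A) = L / (4 * A) + L / (4 * A) := by field_simp; norm_num
    have h3 : 1 ≤ (L:ℝ) / (4 * A) := by rw [le_div_iff₀ (by linarith)]; nlinarith
    linarith
  have hWpos : (0:ℝ) < W := lt_of_lt_of_le (by positivity) hW2
  have hWpos' : 0 < W := by exact_mod_cast hWpos
  have hεW : ε * W ≤ 1 / 2 := by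
    calc ε * W ≤ ε * (L / (2 * A)) := by gcongr
      _ = (ε * L) / (2 * A) := by ring
      _ ≤ A / (2 * A) := by gcongr
      _ = 1 / 2 := by field_simp
  set T : Finset (ℕ × ℕ) := range (L / W + 1) ×ˢ range k with hT
  have hTcard : (T.card : ℝ) ≤ Y := by
    rw [hT, card_product, card_range, card_range]
    push_cast
    have h1 : ((L / W : ℕ) : ℝ) ≤ L / W := Nat.cast_div_le
    have h2 : (L:ℝ) / W ≤ 4 * A := by
      rw [div_le_iff₀ hWpos]; rw [div_le_iff₀ (by linarith)] at hW2; linarith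
    rw [hY]
    apply mul_le_mul (by linarith) hkR (by linarith) (by linarith)
  have hTne : T.Nonempty := ⟨(0, 0), by simp [hT]; omega⟩
  have hTpos : (0:ℝ) < T.card := by exact_mod_cast hTne.card_pos
  obtain ⟨⟨w, s⟩, -, hbox⟩ := exists_le_card_fiber_of_nsmul_le_card_of_maps_to (s := S) (t := T)
    (f := fun h => (h / W, h % k)) (b := (S.card : ℝ) / T.card) (by
      intro x hx
      have := mem_range.mp (hS hx)
      simp only [hT, mem_product, mem_range]
      have := Nat.div_le_div_right (c := W) this.le
      exact ⟨by omega, Nat.mod_lt _ hk1⟩) hTne (by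
      rw [nsmul_eq_mul]; apply le_of_eq; field_simp)
  set S' := S.filter (fun h => (h / W, h % k) = (w, s)) with hS'
  have hS'card : (L:ℝ) / (D * Y) ≤ S'.card := by
    calc (L:ℝ) / (D * Y) = L / D / Y := by rw [div_div]
      _ ≤ S.card / Y := by gcongr
      _ ≤ S.card / T.card := by gcongr
      _ ≤ _ := hbox
  have hS'ne : S'.Nonempty := by
    rw [← card_pos]
    have : (0:ℝ) < S'.card := lt_of_lt_of_le (by positivity) hS'card
    exact_mod_cast this
  obtain ⟨x, hx, y, hy, hxy, hsp⟩ := spread S' hS'ne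
  simp only [hS', mem_filter, Prod.mk.injEq] at hx hy
  obtain ⟨hxS, hxw, hxs⟩ := hx
  obtain ⟨hyS, hyw, hys⟩ := hy
  have hdvd : k ∣ y - x := (Nat.modEq_iff_dvd' hxy).mp (hxs.trans hys.symm)
  obtain ⟨t, ht⟩ := hdvd
  have hyx : (y:ℝ) - x = k * t := by rw [← Nat.cast_sub hxy, ht]; push_cast; ring
  have hltW : y - x ≤ W := by
    have h1 := Nat.div_add_mod x W
    have h2 := Nat.div_add_mod y W
    have h3 := Nat.mod_lt y hWpos'
    rw [hxw] at h1; rw [hyw] at h2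
    omega
  have hspR : (L:ℝ) / (2 * (D * Y)) ≤ k * t := by
    have h1 : (S'.card : ℝ) ≤ (y:ℝ) - x + 1 := by
      rw [← Nat.cast_sub hxy]; exact_mod_cast hsp
    have h2 : (L:ℝ) / (D * Y) = L / (2 * (D * Y)) + L / (2 * (D * Y)) := by field_simp; norm_num
    have h3 : 1 ≤ (L:ℝ) / (2 * (D * Y)) := by
      rw [le_div_iff₀ (by positivity)]; nlinarith
    linarith
  have htW : (t:ℝ) ≤ W := by
    have h1 : t ≤ k * t := Nat.le_mul_of_pos_left _ hk1
    exact_mod_cast h1.trans (ht ▸ hltW)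
  set γ := k * β - a with hγ
  have hnnγ : nn (t * γ) ≤ ε := by
    have h1 := hε y hyS x hxS
    have h2 : β * ((y:ℝ) - x) = t * γ + ((t * a : ℤ) : ℝ) := by
      rw [hyx, hγ]; push_cast; ring
    rw [h2, nn_add_int] at h1; exact h1
  have hγε : |γ| ≤ ε := ha ▸ hk
  have htγ : |(t:ℝ) * γ| ≤ 1 / 2 := by
    rw [abs_mul, Nat.abs_cast]
    calc (t:ℝ) * |γ| ≤ W * ε := by gcongr
      _ ≤ 1 / 2 := by linarith
  rw [nn_eq_abs htγ, abs_mul, Nat.abs_cast] at hnnγ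
  rw [← ha]
  rw [le_div_iff₀ hLpos]
  rw [div_le_iff₀ (by positivity)] at hspR
  calc |γ| * L ≤ |γ| * (k * t * (2 * (D * Y))) := by gcongr
    _ = (t * |γ|) * k * (2 * (D * Y)) := by ring
    _ ≤ ε * (2 * D + 1) * (2 * (D * Y)) := by gcongr
    _ = _ := by ring

def WT (d : ℕ) : Prop := ∃ C : ℕ, ∀ B : ℝ, 2 ≤ B → ∃ L₀ : ℕ, ∀ L : ℕ, L₀ ≤ L →
  ∀ p : ℝ[X], p.natDegree ≤ d → (L:ℝ) / B ≤ ‖∑ n ∈ range L, ee (p.eval (n:ℝ))‖ →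
  ∃ k : ℕ, 1 ≤ k ∧ (k:ℝ) ≤ B ^ C ∧ nn (k * p.coeff d) ≤ B ^ C / (L:ℝ) ^ d

lemma WT_one : WT 1 := by
  refine ⟨1, fun B hB => ⟨1, fun L hL p hp h => ⟨1, le_rfl, by simp; linarith, ?_⟩⟩⟩
  have hLpos : (0:ℝ) < L := by exact_mod_cast hL
  have hev : ∀ n : ℕ, ee (p.eval (n:ℝ)) = ee (p.coeff 0) * ee (p.coeff 1) ^ n := by
    intro n
    rw [eval_eq_sum_range' (Nat.lt_succ_of_le hp)]
    simp only [sum_range_succ, sum_range_zero, pow_zero, mul_one, pow_one, zero_add]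
    rw [ee_add]
    congr 1
    induction n with
    | zero => simp [ee_zero]
    | succ n ih => rw [pow_succ, ← ih, ← ee_add]; push_cast; ring_nf
  simp_rw [hev] at h
  rw [← mul_sum, norm_mul, norm_ee, one_mul] at h
  have h1 := geom_sum_mul (ee (p.coeff 1)) L
  have h2 := congrArg norm h1
  rw [norm_mul] at h2
  have h3 : ‖ee (p.coeff 1) ^ L - 1‖ ≤ 2 := by
    refine (norm_sub_le _ _).trans ?_
    rw [norm_pow, norm_ee]; norm_num
  have h4 := four_nn_le (p.coeff 1)
  have h5 : (L:ℝ) / B * (4 * nn (p.coeff 1)) ≤ 2 := by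
    refine le_trans ?_ (h2.le.trans h3)
    gcongr
  rw [Nat.cast_one, one_mul, pow_one, pow_one, le_div_iff₀ hLpos]
  have h6 : (L:ℝ) / B * (4 * nn (p.coeff 1)) = (nn (p.coeff 1) * L) * 4 / B := by ring
  rw [h6, div_le_iff₀ (by linarith)] at h5
  linarith

/-- van der Corput step. -/
lemma vdc (f : ℕ → ℂ) (hf : ∀ n, ‖f n‖ ≤ 1) (L L' : ℕ) (B : ℝ) (hB : 0 < B) (hL' : 0 < L') (hL : 0 < L)
    (hLL : 4 * B * L' ≤ L) (h : (L:ℝ) / B ≤ ‖∑ n ∈ range L, f n‖) :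
    ∃ t' ∈ range L', ∃ H ⊆ range L', (L':ℝ) ≤ 8 * B ^ 2 * H.card ∧
      ∀ t ∈ H, (L:ℝ) / (8 * B ^ 2) ≤ ‖∑ n ∈ range L, f (n + t) * (starRingEnd ℂ) (f (n + t'))‖ := by
  have hL'R : (0:ℝ) < L' := by exact_mod_cast hL'
  have hLR : (0:ℝ) < L := by exact_mod_cast hL
  have h1 := shift_avg f hf L L' 1
  simp only [one_mul, Nat.cast_one, mul_one] at h1
  have h2 : (L':ℝ) * L / (2 * B) ≤ ‖∑ n ∈ range L, ∑ t ∈ range L', f (n + t)‖ := by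
    refine le_trans ?_ h1
    have e1 : (L':ℝ) * (L / B) ≤ L' * ‖∑ n ∈ range L, f n‖ := by gcongr
    have e2 : (2:ℝ) * L' * L' ≤ L' * L / (2 * B) := by
      rw [le_div_iff₀ (by linarith)]; nlinarith
    have e3 : (L':ℝ) * (L / B) = L' * L / (2 * B) + L' * L / (2 * B) := by field_simp; norm_num
    linarith
  set E : ℕ → ℕ → ℂ := fun t t' => ∑ n ∈ range L, f (n + t) * (starRingEnd ℂ) (f (n + t')) with hE
  have h3 : (‖∑ n ∈ range L, ∑ t ∈ range L', f (n + t)‖) ^ 2 ≤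
      L * ∑ t' ∈ range L', ∑ t ∈ range L', ‖E t t'‖ := by
    have c1 : (‖∑ n ∈ range L, ∑ t ∈ range L', f (n + t)‖) ^ 2 ≤
        (∑ n ∈ range L, ‖∑ t ∈ range L', f (n + t)‖) ^ 2 := by
      gcongr; exact norm_sum_le _ _
    have c2 := sq_sum_le_card_mul_sum_sq (s := range L) (f := fun n => ‖∑ t ∈ range L', f (n + t)‖)
    rw [card_range] at c2
    refine c1.trans (c2.trans ?_)
    gcongr
    have c3 : ((∑ n ∈ range L, ‖∑ t ∈ range L', f (n + t)‖ ^ 2 : ℝ) : ℂ)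
        = ∑ t' ∈ range L', ∑ t ∈ range L', E t t' := by
      push_cast
      have : ∀ n, ((‖∑ t ∈ range L', f (n + t)‖ : ℂ)) ^ 2 =
          ∑ t' ∈ range L', ∑ t ∈ range L', f (n + t) * (starRingEnd ℂ) (f (n + t')) := by
        intro n
        rw [← Complex.mul_conj', map_sum, sum_mul_sum, sum_comm]
      simp_rw [this]
      rw [sum_comm]
      refine sum_congr rfl fun t' _ => ?_
      rw [sum_comm]
    have c4 : ∑ n ∈ range L, ‖∑ t ∈ range L', f (n + t)‖ ^ 2
        = ‖∑ t' ∈ range L', ∑ t ∈ range L', E t t'‖ := by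
      rw [← c3, Complex.norm_real, Real.norm_of_nonneg (by positivity)]
    rw [c4]
    exact (norm_sum_le _ _).trans (sum_le_sum fun _ _ => norm_sum_le _ _)
  have h4 : (L':ℝ) ^ 2 * L / (4 * B ^ 2) ≤ ∑ t' ∈ range L', ∑ t ∈ range L', ‖E t t'‖ := by
    have : ((L':ℝ) * L / (2 * B)) ^ 2 ≤ L * ∑ t' ∈ range L', ∑ t ∈ range L', ‖E t t'‖ :=
      le_trans (by gcongr) h3
    have e : ((L':ℝ) * L / (2 * B)) ^ 2 = L * ((L':ℝ) ^ 2 * L / (4 * B ^ 2)) := by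
      field_simp; norm_num
    rw [e] at this
    exact le_of_mul_le_mul_left this hLR
  obtain ⟨t', ht', h5⟩ : ∃ t' ∈ range L', (L':ℝ) * L / (4 * B ^ 2) ≤ ∑ t ∈ range L', ‖E t t'‖ := by
    apply exists_le_of_sum_le (nonempty_range_iff.mpr hL'.ne')
    rw [sum_const, card_range, nsmul_eq_mul]
    refine le_trans (le_of_eq ?_) h4
    ring
  refine ⟨t', ht', (range L').filter (fun t => (L:ℝ) / (8 * B ^ 2) ≤ ‖E t t'‖), filter_subset _ _, ?_,
    fun t ht => (mem_filter.mp ht).2⟩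
  set H := (range L').filter (fun t => (L:ℝ) / (8 * B ^ 2) ≤ ‖E t t'‖)
  have hEle : ∀ t, ‖E t t'‖ ≤ L := by
    intro t
    refine (norm_sum_le _ _).trans ?_
    refine (sum_le_sum (g := fun _ => (1:ℝ)) fun n _ => ?_).trans (by simp)
    rw [norm_mul, RCLike.norm_conj]
    exact mul_le_one₀ (hf _) (norm_nonneg _) (hf _)
  have h6 : ∑ t ∈ range L', ‖E t t'‖ ≤ H.card * L + L' * (L / (8 * B ^ 2)) := by
    rw [← sum_filter_add_sum_filter_not (range L') (fun t => (L:ℝ) / (8 * B ^ 2) ≤ ‖E t t'‖)]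
    apply add_le_add
    · refine (sum_le_sum fun t _ => hEle t).trans ?_
      rw [sum_const, nsmul_eq_mul]
    · refine (sum_le_sum (g := fun _ => (L:ℝ) / (8 * B ^ 2)) fun t ht => ?_).trans ?_
      · exact (not_le.mp (mem_filter.mp ht).2).le
      · rw [sum_const, nsmul_eq_mul]
        gcongr
        exact (card_filter_le _ _).trans (by simp)
  have h7 : (L':ℝ) * L / (8 * B ^ 2) ≤ H.card * L := by
    have e3 : (L':ℝ) * L / (4 * B ^ 2) = L' * (L / (8 * B ^ 2)) + L' * L / (8 * B ^ 2) := by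
      field_simp; norm_num
    linarith
  rw [div_le_iff₀ (by positivity)] at h7
  have : (L':ℝ) * L ≤ (8 * B ^ 2 * H.card) * L := by linarith
  exact le_of_mul_le_mul_right this hLR

lemma WT_succ (d : ℕ) (hd : 1 ≤ d) (hWT : WT d) : WT (d + 1) := by
  obtain ⟨C, hC⟩ := hWT
  -- parameters
  have hQ : PB (fun B => (8 * B ^ 2) ^ C) := ((PB.const 8).mul (PB.id.pow 2)).pow C
  have hDp : PB (fun B => 8 * B ^ 2 * (8 * B ^ 2) ^ C) := ((PB.const 8).mul (PB.id.pow 2)).mul hQ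
  have h2D1 : PB (fun B => 2 * (8 * B ^ 2 * (8 * B ^ 2) ^ C) + 1) :=
    ((PB.const 2).mul hDp).add (PB.const 1)
  have hYp : PB (fun B => (4 * (2 * (8 * B ^ 2) ^ C) + 1) * (2 * (8 * B ^ 2 * (8 * B ^ 2) ^ C) + 1)) :=
    (((PB.const 4).mul ((PB.const 2).mul hQ)).add (PB.const 1)).mul h2D1
  have hf1 : PB (fun B => (2 * (8 * B ^ 2 * (8 * B ^ 2) ^ C) + 1) * (8 * B ^ 2) ^ C * ((d + 1 : ℕ) : ℝ)) :=
    (h2D1.mul hQ).mul (PB.const _)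
  have hf2 : PB (fun B => 2 * (8 * B ^ 2) ^ C * (2 * (8 * B ^ 2 * (8 * B ^ 2) ^ C) + 1) *
      (2 * (8 * B ^ 2 * (8 * B ^ 2) ^ C) *
        ((4 * (2 * (8 * B ^ 2) ^ C) + 1) * (2 * (8 * B ^ 2 * (8 * B ^ 2) ^ C) + 1))) * (8 * B)) :=
    ((((PB.const 2).mul hQ).mul h2D1).mul (((PB.const 2).mul hDp).mul hYp)).mul
      ((PB.const 8).mul PB.id)
  obtain ⟨C', hC'⟩ := hf1.le₂ hf2
  refine ⟨C', fun B hB => ?_⟩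
  obtain ⟨hb1, hb2⟩ := hC' B hB
  clear hC' hQ hDp h2D1 hYp hf1 hf2
  have hB1 : (2:ℝ) ≤ 8 * B ^ 2 := by nlinarith
  obtain ⟨L₀, hL₀⟩ := hC (8 * B ^ 2) hB1
  set B1 : ℝ := 8 * B ^ 2 with hB1def
  set Q : ℝ := B1 ^ C with hQdef
  have hQ1 : 1 ≤ Q := one_le_pow₀ (by linarith)
  set D : ℝ := B1 * Q with hDdef
  have hD1 : 1 ≤ D := by nlinarith
  set A : ℝ := 2 * Q with hAdef
  set Y : ℝ := (4 * A + 1) * (2 * D + 1) with hYdef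
  set Z : ℝ := 8 * A + 2 * D * Y + 4 * D with hZdef
  have hY0 : 0 ≤ Y := by positivity
  refine ⟨max L₀ ⌈8 * B * (Z + 1)⌉₊, fun L hL p hp hsum => ?_⟩
  have hLL₀ : L₀ ≤ L := (le_max_left _ _).trans hL
  have hLZ : 8 * B * (Z + 1) ≤ L := (Nat.le_ceil _).trans (by exact_mod_cast (le_max_right _ _).trans hL)
  have hZ0 : 0 ≤ Z := by positivity
  have hLR : (0:ℝ) < L := by nlinarith
  have hLpos : 0 < L := by exact_mod_cast hLR
  set L' : ℕ := ⌊(L:ℝ) / (4 * B)⌋₊ with hL'def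
  have hL'1 : (L':ℝ) ≤ L / (4 * B) := Nat.floor_le (by positivity)
  have hL'2 : (L:ℝ) / (8 * B) ≤ L' := by
    have h1 : (L:ℝ) / (4 * B) < L' + 1 := Nat.lt_floor_add_one _
    have h2 : (L:ℝ) / (4 * B) = L / (8 * B) + L / (8 * B) := by field_simp; norm_num
    have h3 : 1 ≤ (L:ℝ) / (8 * B) := by rw [le_div_iff₀ (by linarith)]; nlinarith
    linarith
  have hL'Z : Z ≤ L' := by
    refine le_trans ?_ hL'2
    rw [le_div_iff₀ (by linarith)]; nlinarith
  have hL'R : (0:ℝ) < L' := lt_of_lt_of_le (by positivity) hL'2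
  have hL'pos : 0 < L' := by exact_mod_cast hL'R
  have hL'L : (L':ℝ) ≤ L := by
    refine hL'1.trans ?_
    rw [div_le_iff₀ (by linarith)]; nlinarith
  obtain ⟨t', ht', H, hHsub, hHcard, hH⟩ := vdc (fun n => ee (p.eval (n:ℝ))) (fun n => (norm_ee _).le)
    L L' B (by linarith) hL'pos hLpos (by
      rw [le_div_iff₀ (by linarith)] at hL'1; linarith) hsum
  -- apply the inductive hypothesis
  have key : ∀ t ∈ H, ∃ k : ℕ, 1 ≤ k ∧ (k:ℝ) ≤ Q ∧
      nn (k * ((d + 1 : ℕ) * p.coeff (d + 1) * ((t:ℝ) - t'))) ≤ Q / (L:ℝ) ^ d := by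
    intro t ht
    set r : ℝ[X] := p.comp (Polynomial.C 1 * X + Polynomial.C (t:ℝ)) -
      p.comp (Polynomial.C 1 * X + Polynomial.C (t':ℝ)) with hr
    have hcoef : ∀ s : ℝ, (p.comp (Polynomial.C 1 * X + Polynomial.C s)).coeff (d + 1) = p.coeff (d + 1) := by
      intro s
      rw [coeff_affine p (d + 1) hp, sum_range_succ, sum_eq_zero]
      · simp
      · intro i hi
        rw [Nat.choose_eq_zero_of_lt (mem_range.mp hi)]; simp
    have hcoef' : ∀ s : ℝ, (p.comp (Polynomial.C 1 * X + Polynomial.C s)).coeff d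
        = p.coeff d + p.coeff (d + 1) * ((d + 1 : ℕ) * s) := by
      intro s
      rw [coeff_affine p (d + 1) hp, sum_range_succ, sum_range_succ, sum_eq_zero]
      · simp
      · intro i hi
        rw [Nat.choose_eq_zero_of_lt (mem_range.mp hi)]; simp
    have hrdeg : r.natDegree ≤ d := by
      rw [natDegree_le_iff_coeff_eq_zero]
      intro N hN
      rcases Nat.lt_or_ge (d + 1) N with h | h
      · rw [hr, coeff_sub, coeff_eq_zero_of_natDegree_lt, coeff_eq_zero_of_natDegree_lt, sub_zero]
        · exact (natDegree_affine p _ hp _ _).trans_lt h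
        · exact (natDegree_affine p _ hp _ _).trans_lt h
      · have : N = d + 1 := by omega
        rw [this, hr, coeff_sub, hcoef, hcoef, sub_self]
    have hrc : r.coeff d = (d + 1 : ℕ) * p.coeff (d + 1) * ((t:ℝ) - t') := by
      rw [hr, coeff_sub, hcoef', hcoef']; ring
    have := hL₀ L hLL₀ r hrdeg (by
      refine (hH t ht).trans (le_of_eq ?_)
      congr 1
      refine sum_congr rfl fun n _ => ?_
      rw [hr, eval_sub, eval_affine, eval_affine, ee_sub]
      push_cast
      simp)
    rwa [hrc] at this
  choose! κ hκ1 hκ2 hκ3 using key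
  have hQfloor : 1 ≤ ⌊Q⌋₊ := Nat.le_floor (by simpa using hQ1)
  have hHpos : 0 < H.card := by
    have : (0:ℝ) < B1 * H.card := lt_of_lt_of_le hL'R hHcard
    have : (0:ℝ) < H.card := pos_of_mul_pos_right this (by linarith)
    exact_mod_cast this
  obtain ⟨k, hkmem, hbox⟩ := exists_le_card_fiber_of_nsmul_le_card_of_maps_to (s := H) (t := Icc 1 ⌊Q⌋₊)
    (f := κ) (b := (H.card : ℝ) / Q) (fun t ht => mem_Icc.mpr ⟨hκ1 t ht, Nat.le_floor (hκ2 t ht)⟩)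
    ⟨1, by simp [hQfloor]⟩ (by
      rw [nsmul_eq_mul, Nat.card_Icc, Nat.add_sub_cancel]
      have := Nat.floor_le (by linarith : 0 ≤ Q)
      calc (⌊Q⌋₊ : ℝ) * (H.card / Q) ≤ Q * (H.card / Q) := by gcongr
        _ = H.card := by field_simp)
  set S := H.filter (fun t => κ t = k) with hS
  have hk1 : 1 ≤ k := (mem_Icc.mp hkmem).1
  have hkQ : (k:ℝ) ≤ Q := (Nat.cast_le.mpr (mem_Icc.mp hkmem).2).trans (Nat.floor_le (by linarith))
  set β : ℝ := k * ((d + 1 : ℕ) * p.coeff (d + 1)) with hβ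
  obtain ⟨k2, hk2, hk2D, hfin⟩ := recur β (A / (L:ℝ) ^ d) A D L' S
    ((filter_subset _ _).trans hHsub) (by linarith) hD1 (by positivity) (by
      rw [div_le_iff₀ (by linarith)] at hbox
      calc (L':ℝ) ≤ B1 * H.card := hHcard
        _ ≤ B1 * (S.card * Q) := by gcongr
        _ = _ := by rw [hDdef]; ring) (by
      intro h hh h' hh'
      obtain ⟨hhH, hhk⟩ := mem_filter.mp hh
      obtain ⟨hhH', hhk'⟩ := mem_filter.mp hh'
      have e1 := hκ3 h hhH
      have e2 := hκ3 h' hhH'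
      rw [hhk] at e1
      rw [hhk'] at e2
      have e3 := nn_sub_le (k * ((d + 1 : ℕ) * p.coeff (d + 1) * ((h:ℝ) - t')))
        (k * ((d + 1 : ℕ) * p.coeff (d + 1) * ((h':ℝ) - t')))
      have e4 : k * ((d + 1 : ℕ) * p.coeff (d + 1) * ((h:ℝ) - t')) -
        (k * ((d + 1 : ℕ) * p.coeff (d + 1) * ((h':ℝ) - t'))) = β * ((h:ℝ) - h') := by
        rw [hβ]; ring
      rw [e4] at e3
      have e5 : A / (L:ℝ) ^ d = Q / (L:ℝ) ^ d + Q / (L:ℝ) ^ d := by rw [hAdef]; ring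
      linarith) (by
      have h1 : (L:ℝ) ≤ (L:ℝ) ^ d := by
        have : (1:ℝ) ≤ L := by exact_mod_cast hLpos
        exact le_self_pow₀ this (by omega)
      rw [div_mul_eq_mul_div, div_le_iff₀ (by positivity)]
      have : (L':ℝ) ≤ (L:ℝ) ^ d := hL'L.trans h1
      gcongr) hL'Z
  refine ⟨k2 * k * (d + 1), Nat.mul_pos (Nat.mul_pos hk2 hk1) (Nat.succ_pos d), ?_, ?_⟩
  · refine le_trans ?_ hb1
    push_cast
    gcongr
  · have e1 : ((k2 * k * (d + 1) : ℕ) : ℝ) * p.coeff (d + 1) = k2 * β := by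
      rw [hβ]; push_cast; ring
    rw [e1]
    refine hfin.trans ?_
    have e2 : A / (L:ℝ) ^ d * (2 * D + 1) * (2 * D * Y) / L' ≤
        A / (L:ℝ) ^ d * (2 * D + 1) * (2 * D * Y) / (L / (8 * B)) := by gcongr
    refine e2.trans ?_
    have e3 : A / (L:ℝ) ^ d * (2 * D + 1) * (2 * D * Y) / (L / (8 * B)) =
      (A * (2 * D + 1) * (2 * D * Y) * (8 * B)) / (L:ℝ) ^ (d + 1) := by
      rw [pow_succ]; field_simp
    rw [e3]
    gcongr

lemma WT_all (d : ℕ) (hd : 1 ≤ d) : WT d := by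
  induction d, hd using Nat.le_induction with
  | base => exact WT_one
  | succ n hn ih => exact WT_succ n hn ih

lemma choose_le_two_pow_of_le {i j d : ℕ} (h : i ≤ d) : (i.choose j : ℝ) ≤ 2 ^ d := by
  have h1 : i.choose j ≤ 2 ^ i := Nat.choose_le_two_pow i j
  have h2 : 2 ^ i ≤ 2 ^ d := Nat.pow_le_pow_right (by norm_num) h
  exact_mod_cast h1.trans h2

lemma unwind (R : ℝ[X]) (d : ℕ) (hR : R.natDegree ≤ d) (a v K : ℕ) (hv : 1 ≤ v) (E M : ℝ)
    (hE : 0 ≤ E) (hM : 0 < M) (ha : (a:ℝ) ≤ M)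
    (h : ∀ j, 1 ≤ j → j ≤ d →
      nn (K * (R.comp (Polynomial.C (v:ℝ) * X + Polynomial.C (a:ℝ))).coeff j) ≤ E / M ^ j) :
    ∀ j, 1 ≤ j → j ≤ d →
      nn ((v ^ d * K : ℕ) * R.coeff j) ≤ ((d + 1 : ℕ) * 2 ^ d * v ^ d * E) / M ^ j := by
  intro j hj1 hjd
  set p := R.comp (Polynomial.C (v:ℝ) * X + Polynomial.C (a:ℝ)) with hp
  have hvR : (0:ℝ) < v := by exact_mod_cast hv
  have hpdeg : p.natDegree ≤ d := natDegree_affine R d hR _ _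
  have hRp : R = p.comp (Polynomial.C (1 / v : ℝ) * X + Polynomial.C (-a / v : ℝ)) := by
    rw [hp, comp_assoc]
    have : (Polynomial.C (v:ℝ) * X + Polynomial.C (a:ℝ)).comp
        (Polynomial.C (1 / v : ℝ) * X + Polynomial.C (-a / v : ℝ)) = X := by
      simp only [add_comp, mul_comp, C_comp, X_comp]
      rw [mul_add, ← mul_assoc, ← C_mul, ← C_mul, add_assoc, ← C_add]
      have e1 : (v:ℝ) * (1 / v) = 1 := by field_simp
      have e2 : (v:ℝ) * (-a / v) + a = 0 := by field_simp; ring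
      rw [e1, e2]; simp
    rw [this, comp_X]
  have hco : ((v ^ d * K : ℕ) : ℝ) * R.coeff j = ∑ i ∈ range (d + 1),
      (((i.choose j : ℤ) * (-(a:ℤ)) ^ (i - j) * (v:ℤ) ^ (d - i) : ℤ) : ℝ) * (K * p.coeff i) := by
    conv_lhs => rw [hRp, coeff_affine p d hpdeg]
    rw [mul_sum]
    refine sum_congr rfl fun i hi => ?_
    have hid : i ≤ d := Nat.lt_succ_iff.mp (mem_range.mp hi)
    rcases Nat.lt_or_ge i j with hij | hij
    · rw [Nat.choose_eq_zero_of_lt hij]; simp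
    · push_cast
      have e1 : (v:ℝ) ^ d = v ^ (d - i) * v ^ (i - j) * v ^ j := by
        rw [← pow_add, ← pow_add]; congr 1; omega
      rw [e1, div_pow, div_pow, one_pow]
      field_simp
  rw [hco]
  refine (nn_sum_le _ _).trans ?_
  have hterm : ∀ i ∈ range (d + 1), nn ((((i.choose j : ℤ) * (-(a:ℤ)) ^ (i - j) * (v:ℤ) ^ (d - i) : ℤ) : ℝ)
      * (K * p.coeff i)) ≤ 2 ^ d * v ^ d * E / M ^ j := by
    intro i hi
    have hid : i ≤ d := Nat.lt_succ_iff.mp (mem_range.mp hi)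
    rcases Nat.lt_or_ge i j with hij | hij
    · rw [Nat.choose_eq_zero_of_lt hij]; simp [nn]; positivity
    · refine (nn_int_mul _ _).trans ?_
      have e1 : |(((i.choose j : ℤ) * (-(a:ℤ)) ^ (i - j) * (v:ℤ) ^ (d - i) : ℤ) : ℝ)|
          = (i.choose j : ℝ) * a ^ (i - j) * v ^ (d - i) := by
        push_cast
        rw [abs_mul, abs_mul, abs_pow, abs_pow, abs_neg, Nat.abs_cast, Nat.abs_cast, Nat.abs_cast]
      rw [e1]
      calc (i.choose j : ℝ) * a ^ (i - j) * v ^ (d - i) * nn (K * p.coeff i)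
          ≤ 2 ^ d * M ^ (i - j) * v ^ d * (E / M ^ i) := by
            have h1 := choose_le_two_pow_of_le (j := j) hid
            have h2 : (v:ℝ) ^ (d - i) ≤ v ^ d :=
              pow_le_pow_right₀ (by exact_mod_cast hv) (by omega)
            have h3 := h i (by omega) hid
            gcongr
        _ = _ := by
            have : M ^ i = M ^ (i - j) * M ^ j := by rw [← pow_add]; congr 1; omega
            rw [this]; field_simp
  refine (sum_le_sum hterm).trans ?_
  rw [sum_const, card_range, nsmul_eq_mul]
  apply le_of_eq; ring

def WF (d : ℕ) : Prop := ∃ C : ℕ, ∀ B : ℝ, 2 ≤ B → ∃ L₀ : ℕ, ∀ L : ℕ, L₀ ≤ L →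
  ∀ p : ℝ[X], p.natDegree ≤ d → (L:ℝ) / B ≤ ‖∑ n ∈ range L, ee (p.eval (n:ℝ))‖ →
  ∃ k : ℕ, 1 ≤ k ∧ (k:ℝ) ≤ B ^ C ∧ ∀ j, 1 ≤ j → j ≤ d → nn (k * p.coeff j) ≤ B ^ C / (L:ℝ) ^ j

lemma pow_diff (b k t d : ℕ) (X : ℕ) (h : b + k * t ≤ X) :
    ∃ m : ℕ, m ≤ t * ((d + 1) * X ^ d) ∧ (b + k * t) ^ (d + 1) = b ^ (d + 1) + k * m := by
  refine ⟨t * ∑ i ∈ range (d + 1), (b + k * t) ^ i * b ^ (d - i), ?_, ?_⟩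
  · gcongr
    refine (sum_le_sum (g := fun _ => X ^ d) fun i hi => ?_).trans (by simp)
    have hid : i ≤ d := Nat.lt_succ_iff.mp (mem_range.mp hi)
    calc (b + k * t) ^ i * b ^ (d - i) ≤ X ^ i * X ^ (d - i) := by
          gcongr; omega
      _ = X ^ d := by rw [← pow_add]; congr 1; omega
  · have h := geom_sum₂_mul (((b + k * t : ℕ)) : ℤ) (b:ℤ) (d + 1)
    simp only [Nat.add_sub_cancel] at h
    have : (((b + k * t) ^ (d + 1) : ℕ) : ℤ) =
        ((b ^ (d + 1) + k * (t * ∑ i ∈ range (d + 1), (b + k * t) ^ i * b ^ (d - i)) : ℕ) : ℤ) := by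
      push_cast at h ⊢
      have h' : ∑ x ∈ range (d + 1), ((b:ℤ) + k * t) ^ x * (b:ℤ) ^ (d + 1 - 1 - x) =
        ∑ x ∈ range (d + 1), ((b:ℤ) + k * t) ^ x * (b:ℤ) ^ (d - x) := rfl
      linear_combination -h
    exact_mod_cast this

set_option maxHeartbeats 1600000 in
lemma WF_succ (d : ℕ) (ih : WF d) : WF (d + 1) := by
  obtain ⟨C1, hC1⟩ := WT_all (d + 1) (by omega)
  obtain ⟨C2, hC2⟩ := ih
  have hQ : PB (fun B => B ^ C1) := PB.id.pow C1
  have hQ2 : PB (fun B => (4 * B) ^ C2) := ((PB.const 4).mul PB.id).pow C2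
  have hX : PB (fun B => 32 * B * B ^ C1 * ((d + 1 : ℕ) * 2 ^ (d + 1))) :=
    (((PB.const 32).mul PB.id).mul hQ).mul (PB.const _)
  have hf1 : PB (fun B => (B ^ C1) ^ d * (4 * B) ^ C2 * B ^ C1) := ((hQ.pow d).mul hQ2).mul hQ
  have hf2 : PB (fun B => B ^ C1 * (((d + 1 : ℕ) * 2 ^ d) * (B ^ C1) ^ d *
      ((4 * B) ^ C2 * (2 * (32 * B * B ^ C1 * ((d + 1 : ℕ) * 2 ^ (d + 1)))) ^ d))) :=
    hQ.mul (((PB.const _).mul (hQ.pow d)).mul (hQ2.mul (((PB.const 2).mul hX).pow d)))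
  obtain ⟨C', hC'⟩ := hf1.le₂ hf2
  refine ⟨C', fun B hB => ?_⟩
  obtain ⟨hb1, hb2⟩ := hC' B hB
  clear hC' hQ hQ2 hX hf1 hf2
  obtain ⟨L₁, hL₁⟩ := hC1 B hB
  obtain ⟨L₂, hL₂⟩ := hC2 (4 * B) (by linarith)
  set Q : ℝ := B ^ C1 with hQdef
  set Q2 : ℝ := (4 * B) ^ C2 with hQ2def
  have hQ1 : 1 ≤ Q := one_le_pow₀ (by linarith)
  have hQ21 : 1 ≤ Q2 := one_le_pow₀ (by linarith)
  set c : ℝ := (d + 1 : ℕ) * 2 ^ (d + 1) with hc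
  have hc1 : 1 ≤ c := by
    have h1 : (1:ℝ) ≤ (d + 1 : ℕ) := by exact_mod_cast Nat.succ_pos d
    have h2 : (1:ℝ) ≤ 2 ^ (d + 1) := one_le_pow₀ (by norm_num)
    nlinarith
  set X : ℝ := 32 * B * Q * c with hXdef
  have hBQ : 2 ≤ B * Q := by nlinarith
  have hX1 : 32 * (B * Q) ≤ X := by
    have : X = 32 * (B * Q) * c := by rw [hXdef]; ring
    nlinarith
  refine ⟨max L₁ ⌈2 * X * (L₂ + 1)⌉₊, fun L hL p hp hsum => ?_⟩
  have hLL₁ : L₁ ≤ L := (le_max_left _ _).trans hL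
  have hLX : 2 * X * (L₂ + 1) ≤ L :=
    (Nat.le_ceil _).trans (by exact_mod_cast (le_max_right _ _).trans hL)
  have hL2nn : (0:ℝ) ≤ L₂ := Nat.cast_nonneg _
  have hLR : (0:ℝ) < L := by nlinarith
  have hLpos : 0 < L := by exact_mod_cast hLR
  obtain ⟨k, hk1, hkQ, hka⟩ := hL₁ L hLL₁ p hp hsum
  have hkpos : (1:ℝ) ≤ k := by exact_mod_cast hk1
  set L' : ℕ := ⌊(L:ℝ) / X⌋₊ with hL'def
  have hXpos : 0 < X := by linarith
  have hL'1 : (L':ℝ) ≤ L / X := Nat.floor_le (by positivity)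
  have hL'2 : (L:ℝ) / (2 * X) ≤ L' := by
    have h1 : (L:ℝ) / X < L' + 1 := Nat.lt_floor_add_one _
    have h2 : (L:ℝ) / X = L / (2 * X) + L / (2 * X) := by field_simp; norm_num
    have h3 : 1 ≤ (L:ℝ) / (2 * X) := by rw [le_div_iff₀ (by linarith)]; nlinarith
    linarith
  have hL'L₂ : L₂ ≤ L' := by
    have : (L₂:ℝ) ≤ L' := by
      refine le_trans ?_ hL'2
      rw [le_div_iff₀ (by linarith)]; nlinarith
    exact_mod_cast this
  have hL'R : (0:ℝ) < L' := lt_of_lt_of_le (by positivity) hL'2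
  have hL'X : (L':ℝ) * X ≤ L := by rwa [le_div_iff₀ hXpos] at hL'1
  set f : ℕ → ℂ := fun n => ee (p.eval (n:ℝ)) with hf
  have hsh := shift_avg f (fun n => (norm_ee _).le) L L' k
  have hkL' : 4 * B * (k * L') ≤ L := by
    calc 4 * B * (k * L') ≤ 4 * B * (Q * L') := by gcongr
      _ = L' * (4 * (B * Q)) := by ring
      _ ≤ L' * X := by gcongr; linarith
      _ ≤ L := hL'X
  have hsh2 : (L':ℝ) * L / (2 * B) ≤ ‖∑ n ∈ range L, ∑ t ∈ range L', f (n + k * t)‖ := by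
    refine le_trans ?_ hsh
    have e1 : (L':ℝ) * (L / B) ≤ L' * ‖∑ n ∈ range L, f n‖ := by gcongr
    have e2 : (2:ℝ) * k * L' * L' ≤ L' * L / (2 * B) := by
      rw [le_div_iff₀ (by linarith)]; nlinarith
    have e3 : (L':ℝ) * (L / B) = L' * L / (2 * B) + L' * L / (2 * B) := by field_simp; norm_num
    linarith
  obtain ⟨b, hb, hbsum⟩ : ∃ b ∈ range L, (L':ℝ) / (2 * B) ≤ ‖∑ t ∈ range L', f (b + k * t)‖ := by
    apply exists_le_of_sum_le (nonempty_range_iff.mpr hLpos.ne')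
    rw [sum_const, card_range, nsmul_eq_mul]
    refine le_trans (le_of_eq ?_) (hsh2.trans (norm_sum_le _ _))
    ring
  have hbL : b < L := mem_range.mp hb
  set a := p.coeff (d + 1) with ha
  set q : ℝ[X] := p - Polynomial.C a * Polynomial.X ^ (d + 1) with hq
  have hqc : ∀ j, j ≤ d → q.coeff j = p.coeff j := by
    intro j hj
    rw [hq, coeff_sub, coeff_C_mul_X_pow, if_neg (by omega), sub_zero]
  have hqdeg : q.natDegree ≤ d := by
    rw [natDegree_le_iff_coeff_eq_zero]
    intro N hN
    rw [hq, coeff_sub, coeff_C_mul_X_pow]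
    split_ifs with h
    · rw [h, ha, sub_self]
    · rw [coeff_eq_zero_of_natDegree_lt (by omega), sub_zero]
  have hclose : ∀ t ∈ range L', ‖f (b + k * t) - ee (q.eval ((b + k * t : ℕ) : ℝ)) * ee (a * b ^ (d + 1))‖
      ≤ 1 / (4 * B) := by
    intro t ht
    have htL' : t < L' := mem_range.mp ht
    rw [← ee_add, hf]
    refine (norm_ee_sub_ee_le _ _).trans ?_
    have hle : b + k * t ≤ 2 * L := by
      have h1 : k * t ≤ k * L' := by gcongr
      have h2 : (k * L' : ℝ) ≤ L := by nlinarith [mul_nonneg (by linarith : (0:ℝ) ≤ k) hL'R.le]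
      have h3 : k * L' ≤ L := by exact_mod_cast h2
      omega
    obtain ⟨m, hm, hmeq⟩ := pow_diff b k t d (2 * L) hle
    have e1 : p.eval ((b + k * t : ℕ) : ℝ) - (q.eval ((b + k * t : ℕ) : ℝ) + a * b ^ (d + 1))
        = m * (k * a) := by
      have : (((b + k * t : ℕ) : ℝ)) ^ (d + 1) = b ^ (d + 1) + k * m := by exact_mod_cast hmeq
      rw [hq, eval_sub, eval_mul, eval_C, eval_pow, eval_X, this]; ring
    rw [e1]
    have e2 : (m:ℝ) ≤ L' * ((d + 1 : ℕ) * (2 * L) ^ d) := by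
      have : m ≤ L' * ((d + 1) * (2 * L) ^ d) := hm.trans (by gcongr)
      exact_mod_cast this
    calc 7 * nn (m * (k * a)) ≤ 7 * (m * nn (k * a)) := by gcongr; exact nn_nat_mul _ _
      _ ≤ 7 * ((L' * ((d + 1 : ℕ) * (2 * L) ^ d)) * (Q / (L:ℝ) ^ (d + 1))) := by gcongr
      _ ≤ 8 * ((L' * ((d + 1 : ℕ) * (2 * L) ^ d)) * (Q / (L:ℝ) ^ (d + 1))) := by gcongr; norm_num
      _ = (8 * Q * c / 2 * L') / L := by rw [hc, mul_pow]; field_simp; ring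
      _ ≤ 1 / (4 * B) := by
        rw [div_le_div_iff₀ hLR (by linarith)]
        have : X = 32 * B * Q * c := hXdef
        have : 8 * Q * c / 2 * L' * (4 * B) = L' * X / 2 := by rw [this]; ring
        rw [this]; linarith
  have hqsum : (L':ℝ) / (4 * B) ≤ ‖∑ t ∈ range L', ee ((q.comp (Polynomial.C (k:ℝ) * Polynomial.X + Polynomial.C (b:ℝ))).eval (t:ℝ))‖ := by
    have e1 : ‖∑ t ∈ range L', ee ((q.comp (Polynomial.C (k:ℝ) * Polynomial.X + Polynomial.C (b:ℝ))).eval (t:ℝ))‖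
        = ‖∑ t ∈ range L', ee (q.eval ((b + k * t : ℕ) : ℝ)) * ee (a * b ^ (d + 1))‖ := by
      rw [← sum_mul, norm_mul, norm_ee, mul_one]
      congr 1
      refine sum_congr rfl fun t _ => ?_
      rw [eval_affine]; push_cast; rw [add_comm]
    rw [e1]
    have e2 := norm_sub_norm_le (∑ t ∈ range L', f (b + k * t))
      (∑ t ∈ range L', ee (q.eval ((b + k * t : ℕ) : ℝ)) * ee (a * b ^ (d + 1)))
    rw [← sum_sub_distrib] at e2
    have e3 := (norm_sum_le _ _).trans (sum_le_sum hclose)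
    rw [sum_const, card_range, nsmul_eq_mul] at e3
    have e4 : (L':ℝ) / (2 * B) = L' / (4 * B) + L' * (1 / (4 * B)) := by field_simp; norm_num
    linarith
  obtain ⟨K, hK1, hKQ, hK⟩ := hL₂ L' hL'L₂ _ (natDegree_affine q d hqdeg _ _) hqsum
  have h2X : 1 ≤ 2 * X := by linarith
  have hun := unwind q d hqdeg b k K hk1 (Q2 * (2 * X) ^ d) L (by positivity) hLR
    (by exact_mod_cast hbL.le) (by
      intro j hj1 hjd
      refine (hK j hj1 hjd).trans ?_
      calc Q2 / (L':ℝ) ^ j ≤ Q2 / (L / (2 * X)) ^ j := by gcongr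
        _ = Q2 * (2 * X) ^ j / (L:ℝ) ^ j := by rw [div_pow]; field_simp
        _ ≤ _ := by gcongr)
  refine ⟨k * (k ^ d * K), Nat.mul_pos hk1 (Nat.mul_pos (pow_pos hk1 d) hK1), ?_, ?_⟩
  · refine le_trans ?_ hb1
    push_cast
    calc (k:ℝ) * (k ^ d * K) ≤ Q * (Q ^ d * Q2) := by gcongr
      _ = _ := by ring
  · intro j hj1 hjd
    rcases Nat.lt_or_ge d j with hj | hj
    · have hjd' : j = d + 1 := by omega
      subst hjd'
      have e1 : ((k * (k ^ d * K) : ℕ) : ℝ) * p.coeff (d + 1) = ((k ^ d * K : ℕ) : ℝ) * (k * a) := by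
        push_cast; ring
      rw [e1]
      refine (nn_nat_mul _ _).trans ?_
      calc ((k ^ d * K : ℕ) : ℝ) * nn (k * a) ≤ (Q ^ d * Q2) * (Q / (L:ℝ) ^ (d + 1)) := by
            push_cast; gcongr
        _ = (Q ^ d * Q2 * Q) / (L:ℝ) ^ (d + 1) := by ring
        _ ≤ _ := by gcongr
    · have e1 : ((k * (k ^ d * K) : ℕ) : ℝ) * p.coeff j = (k : ℝ) * (((k ^ d * K : ℕ) : ℝ) * q.coeff j) := by
        rw [hqc j hj]; push_cast; ring
      rw [e1]
      refine (nn_nat_mul _ _).trans ?_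
      calc (k:ℝ) * nn (((k ^ d * K : ℕ) : ℝ) * q.coeff j)
          ≤ Q * (((d + 1 : ℕ) * 2 ^ d * Q ^ d * (Q2 * (2 * X) ^ d)) / (L:ℝ) ^ j) := by
            gcongr
            refine (hun j hj1 hj).trans ?_
            gcongr
        _ = (Q * ((d + 1 : ℕ) * 2 ^ d * Q ^ d * (Q2 * (2 * X) ^ d))) / (L:ℝ) ^ j := by ring
        _ ≤ _ := by gcongr

lemma WF_all (d : ℕ) : WF d := by
  induction d with
  | zero => exact ⟨0, fun B _ => ⟨0, fun L _ p _ _ => ⟨1, le_rfl, by simp, fun j h1 h2 => by omega⟩⟩⟩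
  | succ n ih => exact WF_succ n ih

instance instProbCircle : IsProbabilityMeasure (volume : Measure (AddCircle (1:ℝ))) :=
  ⟨by rw [AddCircle.measure_univ]; simp⟩

instance instProbTorus (m : ℕ) : IsProbabilityMeasure (volume : Measure (Torus m)) := by
  unfold Torus; infer_instance

lemma integral_fourier_ne (n : ℤ) (hn : n ≠ 0) : ∫ t : AddCircle (1:ℝ), fourier n t = 0 :=
  integral_eq_zero_of_add_right_eq_neg (μ := volume) (fourier_add_half_inv_index hn one_pos)

lemma integral_fourier_zero : ∫ t : AddCircle (1:ℝ), fourier 0 t = 1 := by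
  simp_rw [fourier_zero]; simp

lemma cont_int {X : Type*} {E : Type*} [MeasurableSpace X] [TopologicalSpace X] [CompactSpace X]
    [NormedAddCommGroup E] {μ : Measure X} [OpensMeasurableSpace X] [IsFiniteMeasureOnCompacts μ]
    {f : X → E} (hf : Continuous f) : Integrable f μ :=
  hf.integrable_of_hasCompactSupport (HasCompactSupport.of_compactSpace f)

def DM (M : ℕ) (t : AddCircle (1:ℝ)) : ℂ := ∑ j : Fin M, fourier ((j : ℕ) : ℤ) t

def phi (M : ℕ) (t : AddCircle (1:ℝ)) : ℝ := ‖DM M t‖ ^ 2 / M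

lemma continuous_DM (M : ℕ) : Continuous (DM M) := by
  unfold DM; fun_prop

lemma continuous_phi (M : ℕ) : Continuous (phi M) := by
  unfold phi
  have := continuous_DM M
  fun_prop

lemma phi_nonneg (M : ℕ) (t) : 0 ≤ phi M t := by unfold phi; positivity

lemma integral_phi (M : ℕ) (hM : 0 < M) : ∫ t, phi M t = 1 := by
  have hMC : (M:ℂ) ≠ 0 := by exact_mod_cast hM.ne'
  have h1 : ∀ t, ((phi M t : ℝ) : ℂ) =
      (∑ j : Fin M, ∑ l : Fin M, fourier (((j : ℕ) : ℤ) + -((l : ℕ) : ℤ)) t) / M := by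
    intro t
    unfold phi DM
    push_cast
    rw [← Complex.mul_conj', map_sum, sum_mul_sum]
    simp_rw [fourier_add, fourier_neg]
  have h2 : ((∫ t, phi M t : ℝ) : ℂ) = 1 := by
    rw [← integral_complex_ofReal]
    simp_rw [h1]
    rw [integral_div, integral_finsetSum _ (fun j _ => cont_int (by fun_prop))]
    have h3 : ∀ j : Fin M, ∫ t : AddCircle (1:ℝ),
        ∑ l : Fin M, (fourier (((j : ℕ) : ℤ) + -((l : ℕ) : ℤ)) t : ℂ) = 1 := by
      intro j
      rw [integral_finsetSum _ (fun j _ => cont_int (by fun_prop)), sum_eq_single j]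
      · rw [add_neg_cancel]; exact integral_fourier_zero
      · intro b _ hb
        apply integral_fourier_ne
        intro h
        apply hb
        ext
        omega
      · simp
    simp_rw [h3]
    simp [hMC]
  exact_mod_cast h2

lemma fourier_coe_ee (n : ℤ) (x : ℝ) : fourier n (x : AddCircle (1:ℝ)) = ee (n * x) := by
  rw [fourier_coe_apply]; unfold ee; congr 1; push_cast; ring

lemma ee_nat_mul (n : ℕ) (x : ℝ) : ee (n * x) = ee x ^ n := by
  induction n with
  | zero => simp [ee_zero]
  | succ n ih => rw [pow_succ, ← ih, ← ee_add]; push_cast; ring_nf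

lemma phi_second (M : ℕ) (hM : 0 < M) (t : AddCircle (1:ℝ)) : ‖t‖ ^ 2 * phi M t ≤ 1 / (4 * M) := by
  induction t using QuotientAddGroup.induction_on with
  | H x =>
  have hMR : (0:ℝ) < M := by exact_mod_cast hM
  have h1 : DM M (x : AddCircle (1:ℝ)) = ∑ j ∈ range M, ee x ^ j := by
    unfold DM
    rw [← Fin.sum_univ_eq_sum_range (fun j => ee x ^ j)]
    refine sum_congr rfl fun j _ => ?_
    rw [fourier_coe_ee, ← ee_nat_mul]; push_cast; rfl
  have h2 := congrArg norm (geom_sum_mul (ee x) M)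
  rw [norm_mul, ← h1] at h2
  have h3 : ‖ee x ^ M - 1‖ ≤ 2 := by
    refine (norm_sub_le _ _).trans ?_
    rw [norm_pow, norm_ee]; norm_num
  have h4 := four_nn_le x
  have h5 : ‖DM M (x : AddCircle (1:ℝ))‖ * (4 * nn x) ≤ 2 :=
    le_trans (by gcongr) (h2.le.trans h3)
  have h6 : nn x * ‖DM M (x : AddCircle (1:ℝ))‖ ≤ 1 / 2 := by linarith
  have h7 : (nn x * ‖DM M (x : AddCircle (1:ℝ))‖) ^ 2 ≤ (1 / 2) ^ 2 := by gcongr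
  have h8 : (nn x) ^ 2 * (‖DM M (x : AddCircle (1:ℝ))‖ ^ 2 / (M:ℝ))
      = (nn x * ‖DM M (x : AddCircle (1:ℝ))‖) ^ 2 / (M:ℝ) := by ring
  have h9 : (nn x * ‖DM M (x : AddCircle (1:ℝ))‖) ^ 2 / (M:ℝ) ≤ (1 / 2) ^ 2 / (M:ℝ) := by gcongr
  have h10 : ((1:ℝ) / 2) ^ 2 / (M:ℝ) = 1 / (4 * (M:ℝ)) := by field_simp; norm_num
  change (nn x) ^ 2 * (‖DM M (x : AddCircle (1:ℝ))‖ ^ 2 / (M:ℝ)) ≤ _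
  rw [h8, ← h10]; exact h9

def KM (m M : ℕ) (x : Torus m) : ℝ := ∏ i, phi M (x i)

lemma continuous_KM (m M : ℕ) : Continuous (KM m M) := by
  unfold KM
  have := continuous_phi M
  fun_prop

lemma KM_nonneg (m M : ℕ) (x) : 0 ≤ KM m M x := prod_nonneg fun i _ => phi_nonneg _ _

lemma integral_KM (m M : ℕ) (hM : 0 < M) : ∫ x, KM m M x = 1 := by
  unfold KM
  rw [integral_fintype_prod_volume_eq_prod (f := fun _ t => phi M t)]
  simp [integral_phi M hM]

lemma integral_KM_second (m M : ℕ) (hM : 0 < M) (i : Fin m) :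
    ∫ x, ‖x i‖ ^ 2 * KM m M x ≤ 1 / (4 * M) := by
  let ψ : Fin m → AddCircle (1:ℝ) → ℝ :=
    fun j t => if j = i then ‖t‖ ^ 2 * phi M t else phi M t
  have hψi : ∀ t, ψ i t = ‖t‖ ^ 2 * phi M t := fun t => if_pos rfl
  have hψj : ∀ j, j ≠ i → ∀ t, ψ j t = phi M t := fun j hj t => if_neg hj
  have h1 : ∀ x : Torus m, ‖x i‖ ^ 2 * KM m M x = ∏ j, ψ j (x j) := by
    intro x
    unfold KM
    rw [← mul_prod_erase univ (fun j => ψ j (x j)) (mem_univ i),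
      ← mul_prod_erase univ (fun j => phi M (x j)) (mem_univ i), hψi, ← mul_assoc]
    congr 1
    refine prod_congr rfl fun j hj => ?_
    rw [hψj j (ne_of_mem_erase hj)]
  simp_rw [h1]
  rw [integral_fintype_prod_volume_eq_prod (f := ψ)]
  rw [← mul_prod_erase univ _ (mem_univ i), prod_eq_one, mul_one]
  · simp_rw [hψi]
    have hc : Continuous fun t : AddCircle (1:ℝ) => ‖t‖ ^ 2 * phi M t := by
      have := continuous_phi M
      fun_prop
    refine (integral_mono (cont_int hc) (integrable_const _) (phi_second M hM)).trans ?_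
    simp
  · intro j hj
    simp_rw [hψj j (ne_of_mem_erase hj)]
    exact integral_phi M hM

lemma integral_KM_norm (m M : ℕ) (hM : 0 < M) (s : ℝ) (hs : 0 < s) :
    ∫ x, ‖x‖ * KM m M x ≤ s / 2 + m / (8 * M * s) := by
  have hpt : ∀ x : Torus m, ‖x‖ * KM m M x ≤
      s / 2 * KM m M x + 1 / (2 * s) * ∑ i, ‖x i‖ ^ 2 * KM m M x := by
    intro x
    rw [← sum_mul, ← mul_assoc, ← add_mul]
    apply mul_le_mul_of_nonneg_right _ (KM_nonneg _ _ _)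
    rw [pi_norm_le_iff_of_nonneg (by positivity)]
    intro i
    have h1 : ‖x i‖ ^ 2 ≤ ∑ i, ‖x i‖ ^ 2 :=
      single_le_sum (f := fun i => ‖x i‖ ^ 2) (fun _ _ => by positivity) (mem_univ i)
    calc ‖x i‖ ≤ s / 2 + 1 / (2 * s) * ‖x i‖ ^ 2 := by
          have : s / 2 + 1 / (2 * s) * ‖x i‖ ^ 2 - ‖x i‖ = (s - ‖x i‖) ^ 2 / (2 * s) := by
            field_simp; ring
          have : 0 ≤ (s - ‖x i‖) ^ 2 / (2 * s) := by positivity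
          linarith
      _ ≤ _ := by gcongr
  have hK := continuous_KM m M
  have hi1 : Integrable (fun x : Torus m => ‖x‖ * KM m M x) := cont_int (by fun_prop)
  have hi2 : Integrable (fun x : Torus m => s / 2 * KM m M x) := cont_int (by fun_prop)
  have hi3 : ∀ i : Fin m, Integrable (fun x : Torus m => ‖x i‖ ^ 2 * KM m M x) :=
    fun i => cont_int (by fun_prop)
  have hi4 : Integrable (fun x : Torus m => 1 / (2 * s) * ∑ i, ‖x i‖ ^ 2 * KM m M x) :=
    cont_int (by fun_prop)
  refine (integral_mono hi1 (hi2.add hi4) hpt).trans ?_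
  simp only [Pi.add_apply]
  rw [integral_add hi2 hi4, integral_const_mul, integral_const_mul, integral_KM m M hM,
    integral_finsetSum _ (fun i _ => hi3 i)]
  have h5 := sum_le_sum (s := univ) fun i _ => integral_KM_second m M hM i
  rw [sum_const, card_univ, Fintype.card_fin, nsmul_eq_mul] at h5
  have hMR : (0:ℝ) < M := by exact_mod_cast hM
  calc s / 2 * 1 + 1 / (2 * s) * ∑ i : Fin m, ∫ x : Torus m, ‖x i‖ ^ 2 * KM m M x
      ≤ s / 2 * 1 + 1 / (2 * s) * (m * (1 / (4 * M))) := by gcongr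
    _ = _ := by field_simp; ring

/-! Lipschitz norm -/

lemma lip_bdd {m : ℕ} {F : Torus m → ℝ} {L : NNReal} (hF : LipschitzWith L F) :
    BddAbove (Set.range fun x => |F x|) := by
  have : IsCompact (Set.range fun x => |F x|) := isCompact_range (hF.continuous.abs)
  exact this.bddAbove

lemma lip_inf_nonneg {m : ℕ} (F : Torus m → ℝ) :
    0 ≤ sInf {L : ℝ | 0 ≤ L ∧ LipschitzWith (Real.toNNReal L) F} :=
  Real.sInf_nonneg fun _ hx => hx.1

lemma lip_sup_nonneg {m : ℕ} (F : Torus m → ℝ) : 0 ≤ ⨆ x, |F x| :=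
  Real.iSup_nonneg fun _ => abs_nonneg _

lemma abs_le_lipNorm {m : ℕ} {F : Torus m → ℝ} {L : NNReal} (hF : LipschitzWith L F) (x) :
    |F x| ≤ lipNorm F := by
  have := le_ciSup (lip_bdd hF) x
  have := lip_inf_nonneg F
  unfold lipNorm
  linarith

lemma dist_le_lipNorm {m : ℕ} {F : Torus m → ℝ} {L : NNReal} (hF : LipschitzWith L F) (x y) :
    |F x - F y| ≤ lipNorm F * dist x y := by
  have h0 := lip_sup_nonneg F
  have h1 : |F x - F y| ≤ sInf {L : ℝ | 0 ≤ L ∧ LipschitzWith (Real.toNNReal L) F} * dist x y := by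
    rcases (dist_nonneg (x := x) (y := y)).eq_or_lt with h | h
    · have := hF.dist_le_mul x y
      rw [← h, mul_zero] at this ⊢
      rwa [Real.dist_eq] at this
    · rw [← div_le_iff₀ h]
      apply le_csInf
      · exact ⟨L, L.2, by simpa using hF⟩
      · rintro K ⟨hK0, hK⟩
        rw [div_le_iff₀ h]
        have := hK.dist_le_mul x y
        rwa [Real.dist_eq, Real.coe_toNNReal _ hK0] at this
  unfold lipNorm
  nlinarith [dist_nonneg (x := x) (y := y)]

lemma lipNorm_nonneg {m : ℕ} (F : Torus m → ℝ) : 0 ≤ lipNorm F :=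
  add_nonneg (lip_sup_nonneg F) (lip_inf_nonneg F)

lemma lipNorm_le {m : ℕ} {F : Torus m → ℝ} {S L : ℝ} (hS : ∀ x, |F x| ≤ S) (hL0 : 0 ≤ L)
    (hL : ∀ x y, |F x - F y| ≤ L * dist x y) : lipNorm F ≤ S + L := by
  unfold lipNorm
  apply add_le_add
  · exact ciSup_le hS
  · apply csInf_le
    · exact ⟨0, fun _ h => h.1⟩
    · refine ⟨hL0, LipschitzWith.of_dist_le_mul fun x y => ?_⟩
      rw [Real.dist_eq, Real.coe_toNNReal _ hL0]; exact hL x y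

/-! The kernel as an exponential sum -/

open UnitAddTorus in
lemma mFourier_norm_one {m : ℕ} (k : Fin m → ℤ) (x : Torus m) : ‖mFourier k x‖ = 1 := by
  simp only [mFourier, fourier_apply, ContinuousMap.coe_mk, norm_prod, Circle.norm_coe,
      Finset.prod_const_one]

open UnitAddTorus in
lemma mFourier_sub_arg {m : ℕ} (k : Fin m → ℤ) (x y : Torus m) :
    mFourier k (x - y) = mFourier k x * (starRingEnd ℂ) (mFourier k y) := by
  simp only [mFourier, ContinuousMap.coe_mk, map_prod, ← prod_mul_distrib]
  refine prod_congr rfl fun i _ => ?_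
  rw [← fourier_neg]
  simp only [fourier_apply, Pi.sub_apply]
  rw [← Circle.coe_mul, ← AddCircle.toCircle_add]
  congr 2
  rw [neg_smul, smul_sub, sub_eq_add_neg]

open UnitAddTorus in
lemma KM_expand (m M : ℕ) (x : Torus m) : ((KM m M x : ℝ) : ℂ) =
    (∑ k : Fin m → Fin M, ∑ l : Fin m → Fin M,
      mFourier (fun i => ((k i : ℕ) : ℤ) - ((l i : ℕ) : ℤ)) x) / (M:ℂ) ^ m := by
  have h1 : ∏ i, DM M (x i) = ∑ k : Fin m → Fin M, mFourier (fun i => ((k i : ℕ) : ℤ)) x := by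
    unfold DM
    rw [prod_univ_sum, Fintype.piFinset_univ]
    rfl
  have h2 : KM m M x = ‖∏ i, DM M (x i)‖ ^ 2 / (M:ℝ) ^ m := by
    unfold KM phi
    rw [norm_prod, ← prod_pow, prod_div_distrib]; simp
  rw [h2, h1]
  push_cast
  rw [← Complex.mul_conj', map_sum, sum_mul_sum]
  congr 1
  refine sum_congr rfl fun k _ => sum_congr rfl fun l _ => ?_
  rw [← mFourier_neg, ← mFourier_add]
  rfl

open UnitAddTorus in
lemma KM_sum (m M : ℕ) (hM : 0 < M) (len : ℕ) (u : ℕ → Torus m) (τ : ℝ) (hτ : 0 ≤ τ)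
    (h : ∀ k : Fin m → ℤ, k ≠ 0 → (∀ i, |(k i : ℝ)| ≤ M) →
      ‖∑ n ∈ range len, mFourier k (u n)‖ ≤ τ) (y : Torus m) :
    |∑ n ∈ range len, KM m M (y - u n) - len| ≤ (M:ℝ) ^ m * τ := by
  classical
  have hMR : (0:ℝ) < M := by exact_mod_cast hM
  have hMC : (M:ℂ) ≠ 0 := by exact_mod_cast hM.ne'
  have hcard : Fintype.card (Fin m → Fin M) = M ^ m := by simp
  have e0 : ((∑ n ∈ range len, KM m M (y - u n) - len : ℝ) : ℂ) =
      (∑ k : Fin m → Fin M, ∑ l : Fin m → Fin M, (∑ n ∈ range len,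
      mFourier (fun i => ((k i : ℕ) : ℤ) - ((l i : ℕ) : ℤ)) (y - u n)
        - if k = l then (len : ℂ) else 0)) / (M:ℂ) ^ m := by
    push_cast
    simp_rw [KM_expand]
    rw [← sum_div]
    simp only [sum_sub_distrib, sum_ite_eq, mem_univ, if_true, sum_const, card_univ, hcard, nsmul_eq_mul]
    rw [sub_div]
    congr 1
    · congr 1
      rw [sum_comm]
      refine sum_congr rfl fun k _ => ?_
      rw [sum_comm]
    · push_cast; field_simp
  rw [← Real.norm_eq_abs, ← Complex.norm_real, e0, norm_div, norm_pow, Complex.norm_natCast,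
    div_le_iff₀ (by positivity)]
  have hterm : ∀ k l : Fin m → Fin M, ‖∑ n ∈ range len,
      mFourier (fun i => ((k i : ℕ) : ℤ) - ((l i : ℕ) : ℤ)) (y - u n)
        - (if k = l then (len : ℂ) else 0)‖ ≤ τ := by
    intro k l
    split_ifs with hkl
    · have : (fun i => ((k i : ℕ) : ℤ) - ((l i : ℕ) : ℤ)) = 0 := by
        funext i; simp [hkl]
      rw [this, mFourier_zero]
      simpa using hτ
    · rw [sub_zero]
      simp_rw [mFourier_sub_arg]
      rw [← mul_sum, norm_mul, mFourier_norm_one, one_mul, ← map_sum, RCLike.norm_conj]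
      apply h
      · intro h0
        apply hkl
        funext i
        have := congrFun h0 i
        simp only [Pi.zero_apply] at this
        ext
        omega
      · intro i
        have h1 := (k i).2
        have h2 := (l i).2
        have : |((k i : ℕ) : ℤ) - ((l i : ℕ) : ℤ)| ≤ M := by rw [abs_le]; constructor <;> omega
        exact_mod_cast this
  refine (norm_sum_le _ _).trans ?_
  refine (sum_le_sum fun k _ => (norm_sum_le _ _).trans (sum_le_sum fun l _ => hterm k l)).trans ?_
  simp only [sum_const, card_univ, hcard, nsmul_eq_mul]
  push_cast
  apply le_of_eq; ring

open UnitAddTorus in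
lemma disc_bound (m M : ℕ) (hM : 0 < M) (len : ℕ) (u : ℕ → Torus m) (τ : ℝ) (hτ : 0 ≤ τ)
    (h : ∀ k : Fin m → ℤ, k ≠ 0 → (∀ i, |(k i : ℝ)| ≤ M) →
      ‖∑ n ∈ range len, mFourier k (u n)‖ ≤ τ) (F : Torus m → ℝ) (L : NNReal) (hF : LipschitzWith L F)
    (s : ℝ) (hs : 0 < s) :
    |(∑ n ∈ range len, F (u n)) - len * ∫ x, F x| ≤
      len * (lipNorm F * (s / 2 + m / (8 * M * s))) + lipNorm F * ((M:ℝ) ^ m * τ) := by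
  have hFc := hF.continuous
  have hK := continuous_KM m M
  have hΛ := lipNorm_nonneg F
  have hI : ∀ n, Integrable (fun y => F y * KM m M (y - u n)) := fun n => cont_int (by fun_prop)
  have h1 : ∀ n, |F (u n) - ∫ y, F y * KM m M (y - u n)| ≤ lipNorm F * (s / 2 + m / (8 * M * s)) := by
    intro n
    have e1 : F (u n) = ∫ y, F (u n) * KM m M (y - u n) := by
      rw [integral_const_mul, integral_sub_right_eq_self (fun y => KM m M y) (u n), integral_KM m M hM, mul_one]
    have e2 : F (u n) - ∫ y, F y * KM m M (y - u n) = ∫ y, (F (u n) - F y) * KM m M (y - u n) := by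
      conv_lhs => rw [e1]
      rw [← integral_sub (cont_int (by fun_prop)) (hI n)]
      simp_rw [sub_mul]
    rw [e2]
    have e3 : |∫ y, (F (u n) - F y) * KM m M (y - u n)| ≤
        ∫ y, lipNorm F * (‖y - u n‖ * KM m M (y - u n)) := by
      rw [← Real.norm_eq_abs]
      apply norm_integral_le_of_norm_le (cont_int (by fun_prop))
      refine Filter.Eventually.of_forall fun y => ?_
      rw [norm_mul, Real.norm_eq_abs, Real.norm_of_nonneg (KM_nonneg _ _ _), ← mul_assoc]
      apply mul_le_mul_of_nonneg_right _ (KM_nonneg _ _ _)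
      rw [← dist_eq_norm, dist_comm]
      exact dist_le_lipNorm hF _ _
    refine e3.trans ?_
    rw [integral_const_mul, integral_sub_right_eq_self (fun y => ‖y‖ * KM m M y) (u n)]
    gcongr
    exact integral_KM_norm m M hM s hs
  have h2 : |∑ n ∈ range len, (∫ y, F y * KM m M (y - u n)) - len * ∫ x, F x| ≤
      lipNorm F * ((M:ℝ) ^ m * τ) := by
    have e1 : ∑ n ∈ range len, (∫ y, F y * KM m M (y - u n)) - len * ∫ x, F x =
        ∫ y, F y * (∑ n ∈ range len, KM m M (y - u n) - len) := by
      rw [← integral_finsetSum _ (fun n _ => hI n), ← integral_const_mul,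
        ← integral_sub (cont_int (by fun_prop)) (cont_int (by fun_prop))]
      congr 1
      funext y
      rw [mul_sub, mul_sum]; ring
    rw [e1, ← Real.norm_eq_abs]
    have e2 := norm_integral_le_of_norm_le_const (μ := (volume : Measure (Torus m)))
      (f := fun y => F y * (∑ n ∈ range len, KM m M (y - u n) - len))
      (C := lipNorm F * ((M:ℝ) ^ m * τ)) (Filter.Eventually.of_forall fun y => by
        rw [norm_mul, Real.norm_eq_abs, Real.norm_eq_abs]
        exact mul_le_mul (abs_le_lipNorm hF y) (KM_sum m M hM len u τ hτ h y) (abs_nonneg _) hΛ)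
    simpa using e2
  have h3 : |∑ n ∈ range len, F (u n) - ∑ n ∈ range len, (∫ y, F y * KM m M (y - u n))| ≤
      len * (lipNorm F * (s / 2 + m / (8 * M * s))) := by
    rw [← sum_sub_distrib]
    refine (abs_sum_le_sum_abs _ _).trans ((sum_le_sum fun n _ => h1 n).trans ?_)
    simp
  calc _ ≤ |∑ n ∈ range len, F (u n) - ∑ n ∈ range len, (∫ y, F y * KM m M (y - u n))| +
      |∑ n ∈ range len, (∫ y, F y * KM m M (y - u n)) - len * ∫ x, F x| := abs_sub_le _ _ _
    _ ≤ _ := add_le_add h3 h2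

open UnitAddTorus in
lemma fourier_fail (m : ℕ) : ∃ C : ℕ, ∀ B : ℝ, 2 ≤ B → ∀ (len : ℕ) (u : ℕ → Torus m)
    (F : Torus m → ℝ) (L : NNReal), LipschitzWith L F →
    ¬ (|(∑ n ∈ range len, F (u n)) - len * ∫ x, F x| ≤ 1 / B * lipNorm F * len) →
    ∃ k : Fin m → ℤ, k ≠ 0 ∧ (∀ i, |(k i : ℝ)| ≤ B ^ C) ∧
      (len:ℝ) / B ^ C ≤ ‖∑ n ∈ range len, mFourier k (u n)‖ := by
  have hf1 : PB (fun B => m * B ^ 2 + 2) := ((PB.const _).mul (PB.id.pow 2)).add (PB.const 2)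
  have hf2 : PB (fun B => 2 * B * (m * B ^ 2 + 2) ^ m) := ((PB.const 2).mul PB.id).mul (hf1.pow m)
  obtain ⟨C, hC⟩ := hf1.le₂ hf2
  refine ⟨C, fun B hB len u F L hF hfail => ?_⟩
  obtain ⟨hb1, hb2⟩ := hC B hB
  by_contra hno
  push Not at hno
  apply hfail
  set M : ℕ := ⌈(m * B ^ 2 : ℝ)⌉₊ + 1 with hMdef
  have hMpos : 0 < M := Nat.succ_pos _
  have hM1 : m * B ^ 2 ≤ M := by
    have := Nat.le_ceil (m * B ^ 2 : ℝ)
    rw [hMdef]; push_cast; linarith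
  have hM2 : (M:ℝ) ≤ m * B ^ 2 + 2 := by
    have := Nat.ceil_lt_add_one (a := (m * B ^ 2 : ℝ)) (by positivity)
    rw [hMdef]; push_cast; linarith
  have hMR : (0:ℝ) < M := by exact_mod_cast hMpos
  have hBC : (0:ℝ) < B ^ C := by positivity
  have hd := disc_bound m M hMpos len u (len / B ^ C) (by positivity) (fun k hk hkM =>
    (hno k hk (fun i => (hkM i).trans (hM2.trans hb1))).le) F L hF (1 / (2 * B)) (by positivity)
  refine hd.trans ?_
  have hΛ := lipNorm_nonneg F
  have e1 : 1 / (2 * B) / 2 + m / (8 * M * (1 / (2 * B))) ≤ 1 / (2 * B) := by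
    have : (m:ℝ) / (8 * M * (1 / (2 * B))) ≤ 1 / (4 * B) := by
      rw [div_le_div_iff₀ (by positivity) (by positivity)]
      field_simp
      nlinarith
    have : 1 / (2 * B) / 2 = 1 / (4 * B) := by field_simp; norm_num
    have : 1 / (2 * B) = 1 / (4 * B) + 1 / (4 * B) := by field_simp; norm_num
    linarith
  have e2 : (M:ℝ) ^ m * (len / B ^ C) ≤ len * (1 / (2 * B)) := by
    have : (M:ℝ) ^ m * (2 * B) ≤ B ^ C := by
      refine le_trans ?_ hb2
      rw [mul_comm]
      gcongr
    rw [mul_div_assoc', div_le_iff₀ hBC]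
    calc (M:ℝ) ^ m * len = len * (1 / (2 * B)) * ((M:ℝ) ^ m * (2 * B)) := by field_simp
      _ ≤ _ := by gcongr
  calc len * (lipNorm F * (1 / (2 * B) / 2 + m / (8 * M * (1 / (2 * B))))) + lipNorm F * ((M:ℝ) ^ m * (len / B ^ C))
      ≤ len * (lipNorm F * (1 / (2 * B))) + lipNorm F * (len * (1 / (2 * B))) := by gcongr
    _ = _ := by field_simp; ring

lemma torus_dist_le_half {m : ℕ} (x y : Torus m) : dist x y ≤ 1 / 2 := by
  rw [dist_pi_le_iff (by norm_num)]
  intro i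
  rw [dist_eq_norm]
  have := AddCircle.norm_le_half_period (1:ℝ) (x := x i - y i) one_ne_zero
  simpa using this

lemma tot_half (m N : ℕ) (δ : ℝ) (u : ℕ → Torus m) (hδ : 1 / 2 ≤ δ) :
    TotallyEquidistributed m N δ u := by
  intro a d len _ _ _ _ F L hF
  have hΛ := lipNorm_nonneg F
  have hFi : Integrable F := cont_int hF.continuous
  have h1 : ∀ x, |F x - ∫ y, F y| ≤ δ * lipNorm F := by
    intro x
    have e : F x - ∫ y, F y = ∫ y, (F x - F y) := by
      rw [integral_sub (μ := volume) (integrable_const _) hFi]; simp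
    rw [e]
    refine (norm_integral_le_of_norm_le_const (μ := (volume : Measure (Torus m))) (f := fun y => F x - F y) (C := δ * lipNorm F) ?_).trans ?_
    · refine Filter.Eventually.of_forall fun y => ?_
      rw [Real.norm_eq_abs]
      refine (dist_le_lipNorm hF x y).trans ?_
      have := torus_dist_le_half x y
      nlinarith
    · simp
  have h2 : (∑ n ∈ range len, F (u (a + n * d))) - len * ∫ x, F x
      = ∑ n ∈ range len, (F (u (a + n * d)) - ∫ x, F x) := by
    rw [sum_sub_distrib]; simp
  rw [h2]
  refine (abs_sum_le_sum_abs _ _).trans ((sum_le_sum fun n _ => h1 _).trans ?_)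
  simp [mul_comm]

open UnitAddTorus in
lemma mFourier_coe_ee {m : ℕ} (k : Fin m → ℤ) (x : Fin m → ℝ) :
    mFourier k (fun i => ((x i : ℝ) : AddCircle (1:ℝ))) = ee (∑ i, k i * x i) := by
  have h : ∀ s : Finset (Fin m), ee (∑ i ∈ s, k i * x i) = ∏ i ∈ s, ee (k i * x i) := by
    intro s
    induction s using Finset.induction_on with
    | empty => simp [ee_zero]
    | insert a s ha ih => rw [sum_insert ha, prod_insert ha, ee_add, ih]
  rw [h]
  simp only [mFourier, ContinuousMap.coe_mk]
  exact prod_congr rfl fun i _ => fourier_coe_ee _ _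

def lcomb {m : ℕ} (k : Fin m → ℤ) (P : Fin m → ℝ[X]) : ℝ[X] := ∑ i, C ((k i : ℤ) : ℝ) * P i

lemma lcomb_deg {m d : ℕ} (k : Fin m → ℤ) (P : Fin m → ℝ[X]) (h : ∀ i, (P i).natDegree ≤ d) :
    (lcomb k P).natDegree ≤ d := by
  unfold lcomb
  apply natDegree_sum_le_of_forall_le
  intro i _
  exact (natDegree_C_mul_le _ _).trans (h i)

lemma lcomb_eval {m : ℕ} (k : Fin m → ℤ) (P : Fin m → ℝ[X]) (x : ℝ) :
    (lcomb k P).eval x = ∑ i, k i * (P i).eval x := by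
  unfold lcomb
  simp [eval_finsetSum]

lemma lcomb_comp {m : ℕ} (k : Fin m → ℤ) (P : Fin m → ℝ[X]) (t : ℝ[X]) :
    lcomb k (fun i => (P i).comp t) = (lcomb k P).comp t := by
  unfold lcomb
  rw [Polynomial.sum_comp]
  simp

lemma lcomb_smul {m : ℕ} (k : Fin m → ℤ) (P : Fin m → ℝ[X]) (K : ℤ) (j : ℕ) :
    (lcomb (fun i => K * k i) P).coeff j = K * (lcomb k P).coeff j := by
  unfold lcomb
  simp [mul_sum, mul_assoc]

def polyU {m : ℕ} (P : Fin m → ℝ[X]) (n : ℕ) : Torus m :=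
  fun i => (((P i).eval (n : ℝ) : ℝ) : AddCircle (1:ℝ))

open UnitAddTorus in
lemma mFourier_polyU {m : ℕ} (k : Fin m → ℤ) (P : Fin m → ℝ[X]) (n : ℕ) :
    mFourier k (polyU P n) = ee ((lcomb k P).eval (n:ℝ)) := by
  unfold polyU
  rw [mFourier_coe_ee, lcomb_eval]

open UnitAddTorus in
lemma direct (m d : ℕ) : ∃ c : ℕ, ∀ B : ℝ, 2 ≤ B → ∃ M₀ : ℕ, ∀ M : ℕ, M₀ ≤ M →
    ∀ P : Fin m → ℝ[X], (∀ i, (P i).natDegree ≤ d) →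
    ¬ TotallyEquidistributed m M (1 / B) (polyU P) →
    ∃ k : Fin m → ℤ, k ≠ 0 ∧ (∀ i, |(k i : ℝ)| ≤ B ^ c) ∧ ∃ K : ℕ, 1 ≤ K ∧ (K:ℝ) ≤ B ^ c ∧
      ∀ j, 1 ≤ j → j ≤ d → nn (K * (lcomb k P).coeff j) ≤ B ^ c / (M:ℝ) ^ j := by
  obtain ⟨C1, hC1⟩ := fourier_fail m
  obtain ⟨CW, hCW⟩ := WF_all d
  have hpb1 : PB (fun B => B ^ C1) := PB.id.pow C1
  have hpbw : PB (fun B => (B ^ (C1 + 1)) ^ CW) := (PB.id.pow (C1 + 1)).pow CW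
  have hpb2 : PB (fun B => (2 * B) ^ d * (B ^ (C1 + 1)) ^ CW) :=
    (((PB.const 2).mul PB.id).pow d).mul hpbw
  have hpb3 : PB (fun B => ((d+1:ℕ):ℝ) * 2 ^ d * (2 * B) ^ d * ((B ^ (C1 + 1)) ^ CW * B ^ d)) :=
    (((PB.const _).mul (PB.const _)).mul (((PB.const 2).mul PB.id).pow d)).mul
      (hpbw.mul (PB.id.pow d))
  obtain ⟨c, hc⟩ := (hpb1.add hpb2).add hpb3
  refine ⟨c, fun B hB => ?_⟩
  have hB0 : 0 < B := by linarith
  have hc' := (le_abs_self _).trans (hc B hB)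
  have p1 : 0 ≤ B ^ C1 := by positivity
  have p2 : 0 ≤ (2 * B) ^ d * (B ^ (C1 + 1)) ^ CW := by positivity
  have p3 : 0 ≤ ((d+1:ℕ):ℝ) * 2 ^ d * (2 * B) ^ d * ((B ^ (C1 + 1)) ^ CW * B ^ d) := by positivity
  have q1 : B ^ C1 ≤ B ^ c := by simp only at hc'; linarith
  have q2 : (2 * B) ^ d * (B ^ (C1 + 1)) ^ CW ≤ B ^ c := by simp only at hc'; linarith
  have q3 : ((d+1:ℕ):ℝ) * 2 ^ d * (2 * B) ^ d * ((B ^ (C1 + 1)) ^ CW * B ^ d) ≤ B ^ c := by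
    simp only at hc'; linarith
  have hB1 : 2 ≤ B ^ (C1 + 1) := hB.trans (le_self_pow₀ (by linarith) (by omega))
  obtain ⟨L₀, hL₀⟩ := hCW _ hB1
  refine ⟨⌈B * (L₀ + 2)⌉₊, fun M hM P hP hfail => ?_⟩
  have hM' : B * (L₀ + 2) ≤ M := Nat.ceil_le.mp hM
  have hMpos : (0:ℝ) < M := lt_of_lt_of_le (by positivity) hM'
  unfold TotallyEquidistributed at hfail
  push Not at hfail
  obtain ⟨a, v, len, hv, hlen, hin, hδ, F, L, hF, hbad⟩ := hfail
  obtain ⟨k, hk0, hkB, hks⟩ := hC1 B hB len (fun n => polyU P (a + n * v)) F L hF (not_le.mpr hbad)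
  have hlenM : (M:ℝ) ≤ B * len := by
    rw [div_mul_eq_mul_div, one_mul, div_le_iff₀ hB0] at hδ; linarith
  have hlen2 : (L₀:ℝ) + 2 ≤ len := by
    have := hM'.trans hlenM
    exact le_of_mul_le_mul_left this hB0
  have hlenL : L₀ + 2 ≤ len := by exact_mod_cast hlen2
  have haM : a ≤ M := by have := (hin 0 hlen).2; omega
  have hvB : (v:ℝ) ≤ 2 * B := by
    have h1 := (hin (len - 1) (by omega)).2
    have h2 : (len - 1) * v ≤ M := by omega
    have h3 : ((len:ℝ) - 1) * v ≤ M := by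
      have : (((len - 1) * v : ℕ) : ℝ) ≤ M := by exact_mod_cast h2
      rw [Nat.cast_mul, Nat.cast_sub (by omega)] at this
      simpa using this
    have h4 : (len:ℝ) / 2 ≤ (len:ℝ) - 1 := by
      have : (0:ℝ) ≤ L₀ := Nat.cast_nonneg _
      linarith
    have hl0 : (0:ℝ) < len := by exact_mod_cast hlen
    have h5 : (len:ℝ) / 2 * v ≤ B * len :=
      (mul_le_mul_of_nonneg_right h4 (Nat.cast_nonneg _)).trans (h3.trans hlenM)
    have h6 : (len:ℝ) * v ≤ len * (2 * B) := by linarith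
    exact le_of_mul_le_mul_left h6 hl0
  set R := lcomb k P with hR
  have hRd : R.natDegree ≤ d := lcomb_deg k P hP
  obtain ⟨K₀, hK₀1, hK₀2, hK₀⟩ := hL₀ len (by omega) (R.comp (C (v:ℝ) * X + C (a:ℝ)))
    (natDegree_affine R d hRd _ _) (by
      have e : ∀ n : ℕ, ee ((R.comp (C (v:ℝ) * X + C (a:ℝ))).eval (n:ℝ))
          = mFourier k (polyU P (a + n * v)) := by
        intro n
        rw [mFourier_polyU, eval_affine]
        congr 2
        push_cast; ring
      simp_rw [e]
      refine le_trans ?_ hks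
      apply div_le_div_of_nonneg_left (Nat.cast_nonneg _) (by positivity)
      exact pow_le_pow_right₀ (by linarith) (by omega))
  have hl0 : (0:ℝ) < len := by exact_mod_cast hlen
  have hun := unwind R d hRd a v K₀ hv ((B ^ (C1 + 1)) ^ CW * B ^ d) M (by positivity) hMpos
    (by exact_mod_cast haM) (fun j hj1 hjd => by
      refine (hK₀ j hj1 hjd).trans ?_
      rw [div_le_div_iff₀ (by positivity) (by positivity)]
      have : (M:ℝ) ^ j ≤ B ^ d * (len:ℝ) ^ j := by
        calc (M:ℝ) ^ j ≤ (B * len) ^ j := by gcongr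
          _ = B ^ j * len ^ j := mul_pow _ _ _
          _ ≤ B ^ d * len ^ j := by
            gcongr
            linarith
      calc (B ^ (C1 + 1)) ^ CW * (M:ℝ) ^ j ≤ (B ^ (C1 + 1)) ^ CW * (B ^ d * (len:ℝ) ^ j) := by gcongr
        _ = _ := by ring)
  refine ⟨k, hk0, fun i => (hkB i).trans q1, v ^ d * K₀, ?_, ?_, fun j hj1 hjd => ?_⟩
  · exact Nat.one_le_iff_ne_zero.mpr (by positivity)
  · push_cast
    refine le_trans ?_ q2
    gcongr
  · refine (hun j hj1 hjd).trans ?_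
    gcongr
    refine le_trans ?_ q3
    gcongr

lemma dilate (Q : ℝ[X]) (d : ℕ) (hQ : Q.natDegree ≤ d) (q N r K : ℕ) (hq : 1 ≤ q)
    (hr : r < q ^ d) (hT : 1 ≤ N / q ^ d) (A : ℝ) (hA : 0 ≤ A)
    (h : ∀ j, 1 ≤ j → j ≤ d → nn (K * (Q.comp (C (q:ℝ) * X)).coeff j) ≤ A / ((N / q : ℕ) : ℝ) ^ j) :
    ∀ j, 1 ≤ j → j ≤ d →
      nn (K * (Q.comp (C ((q:ℝ) ^ d) * X + C (r:ℝ))).coeff j)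
        ≤ ((d + 1 : ℕ) * 4 ^ d * A) / ((N / q ^ d : ℕ) : ℝ) ^ j := by
  intro j hj1 hjd
  set T := N / q ^ d with hTdef
  set M := N / q with hMdef
  have hTN : T * q ^ d ≤ N := Nat.div_mul_le_self _ _
  have hqdN : q ^ d ≤ N := le_trans (by nlinarith [Nat.one_le_pow d q hq]) hTN
  have hqN : q ≤ N := le_trans (Nat.le_self_pow (by omega) q) hqdN
  have hM1 : 1 ≤ M := (Nat.one_le_div_iff (by omega)).mpr hqN
  have hNM : N ≤ 2 * (q * M) := by
    have h1 := Nat.div_add_mod N q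
    have h2 := Nat.mod_lt N (show q > 0 by omega)
    rw [← hMdef] at h1
    nlinarith
  have hMR : (0:ℝ) < M := by exact_mod_cast hM1
  have hTR : (0:ℝ) < T := by exact_mod_cast hT
  rw [coeff_affine Q d hQ, mul_sum]
  refine (nn_sum_le _ _).trans ?_
  have key : ∀ i ∈ range (d + 1),
      nn (K * (Q.coeff i * (i.choose j * (r:ℝ) ^ (i - j) * ((q:ℝ) ^ d) ^ j)))
        ≤ 4 ^ d * A / (T:ℝ) ^ j := by
    intro i hi
    have hid : i ≤ d := by simpa [Nat.lt_succ_iff] using hi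
    rcases lt_or_ge i j with hij | hij
    · rw [Nat.choose_eq_zero_of_lt hij]
      have : nn (K * (Q.coeff i * (((0:ℕ):ℝ) * (r:ℝ) ^ (i - j) * ((q:ℝ) ^ d) ^ j))) = 0 := by
        simp [nn]
      rw [this]; positivity
    · have hidj : i ≤ d * j := hid.trans (Nat.le_mul_of_pos_right _ hj1)
      have e : (K:ℝ) * (Q.coeff i * (i.choose j * (r:ℝ) ^ (i - j) * ((q:ℝ) ^ d) ^ j))
          = ((i.choose j * r ^ (i - j) * q ^ (d * j - i) : ℕ) : ℝ) *
            (K * (Q.comp (C (q:ℝ) * X)).coeff i) := by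
        rw [comp_C_mul_X_coeff, ← pow_mul]
        have : (q:ℝ) ^ (d * j) = (q:ℝ) ^ (d * j - i) * (q:ℝ) ^ i := by
          rw [← pow_add, Nat.sub_add_cancel hidj]
        rw [this]; push_cast; ring
      rw [e]
      refine (nn_nat_mul _ _).trans ?_
      have hnat : r ^ (i - j) * q ^ (d * j - i) * T ^ j ≤ 2 ^ d * M ^ i := by
        have hqi : 0 < q ^ i := Nat.pow_pos (by omega)
        apply Nat.le_of_mul_le_mul_right _ hqi
        calc r ^ (i - j) * q ^ (d * j - i) * T ^ j * q ^ i
            = r ^ (i - j) * T ^ j * (q ^ (d * j - i) * q ^ i) := by ring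
          _ = r ^ (i - j) * (T * q ^ d) ^ j := by
              rw [← pow_add, Nat.sub_add_cancel hidj, mul_pow, pow_mul]; ring
          _ ≤ N ^ (i - j) * N ^ j := by
              apply Nat.mul_le_mul
              · exact Nat.pow_le_pow_left (hr.le.trans hqdN) _
              · exact Nat.pow_le_pow_left hTN _
          _ = N ^ i := by rw [← pow_add, Nat.sub_add_cancel hij]
          _ ≤ (2 * (q * M)) ^ i := Nat.pow_le_pow_left hNM _
          _ = 2 ^ i * M ^ i * q ^ i := by rw [mul_pow, mul_pow]; ring
          _ ≤ 2 ^ d * M ^ i * q ^ i := by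
              gcongr
              norm_num
      have hreal : (r:ℝ) ^ (i - j) * (q:ℝ) ^ (d * j - i) * (T:ℝ) ^ j ≤ 2 ^ d * (M:ℝ) ^ i := by
        exact_mod_cast hnat
      have hch := choose_le_two_pow_of_le (j := j) hid
      have hi1 := h i (hj1.trans hij) hid
      calc ((i.choose j * r ^ (i - j) * q ^ (d * j - i) : ℕ) : ℝ) *
            nn (K * (Q.comp (C (q:ℝ) * X)).coeff i)
          ≤ ((i.choose j * r ^ (i - j) * q ^ (d * j - i) : ℕ) : ℝ) * (A / (M:ℝ) ^ i) := by gcongr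
        _ = (i.choose j : ℝ) * (((r:ℝ) ^ (i - j) * (q:ℝ) ^ (d * j - i)) * (A / (M:ℝ) ^ i)) := by
            push_cast; ring
        _ ≤ 2 ^ d * ((2 ^ d * (M:ℝ) ^ i / (T:ℝ) ^ j) * (A / (M:ℝ) ^ i)) := by
            gcongr
            rw [le_div_iff₀ (by positivity)]
            exact hreal
        _ = 4 ^ d * A / (T:ℝ) ^ j := by
            rw [show (4:ℝ) = 2 * 2 by norm_num, mul_pow]
            field_simp
  refine (sum_le_sum key).trans ?_
  rw [sum_const, card_range, nsmul_eq_mul]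
  apply le_of_eq; ring

open UnitAddTorus in
lemma mFourier_sub_one_le {m : ℕ} (k : Fin m → ℤ) (z : Torus m) (b : ℝ) (hb : ∀ i, |(k i:ℝ)| ≤ b) :
    ‖mFourier k z - 1‖ ≤ 7 * m * b * ‖z‖ := by
  have : ∀ i, ∃ t : ℝ, (t : AddCircle (1:ℝ)) = z i := fun i => QuotientAddGroup.mk_surjective (z i)
  choose t ht using this
  have hz : z = fun i => ((t i : ℝ) : AddCircle (1:ℝ)) := by funext i; rw [ht]
  have e : mFourier k z = ee (∑ i, k i * t i) := by rw [hz, mFourier_coe_ee]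
  rw [e]
  refine (norm_ee_sub_one_le _).trans ?_
  have h1 : nn (∑ i, k i * t i) ≤ ∑ i : Fin m, b * ‖z‖ := by
    refine (nn_sum_le _ _).trans (sum_le_sum fun i _ => ?_)
    refine (nn_int_mul _ _).trans ?_
    have : nn (t i) ≤ ‖z‖ := by
      change ‖((t i : ℝ) : AddCircle (1:ℝ))‖ ≤ _
      rw [ht]; exact norm_le_pi_norm z i
    have h0 := nn_nonneg (t i)
    exact mul_le_mul (hb i) this h0 ((abs_nonneg _).trans (hb i))
  simp only [sum_const, card_univ, Fintype.card_fin, nsmul_eq_mul] at h1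
  nlinarith

open UnitAddTorus in
lemma mFourier_lip {m : ℕ} (k : Fin m → ℤ) (x y : Torus m) (b : ℝ) (hb : ∀ i, |(k i:ℝ)| ≤ b) :
    ‖mFourier k x - mFourier k y‖ ≤ 7 * m * b * dist x y := by
  have h1 : mFourier k x - mFourier k y = (mFourier k (x - y) - 1) * mFourier k y := by
    rw [mFourier_sub_arg, sub_mul, one_mul, mul_assoc, Complex.conj_mul', mFourier_norm_one]
    simp
  rw [h1, norm_mul, mFourier_norm_one, mul_one, dist_eq_norm]
  exact mFourier_sub_one_le k _ b hb

open UnitAddTorus in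
lemma integral_mFourier_ne {m : ℕ} (k : Fin m → ℤ) (hk : k ≠ 0) : ∫ x : Torus m, mFourier k x = 0 := by
  obtain ⟨i, hi⟩ := Function.ne_iff.mp hk
  have : ∫ x : Torus m, mFourier k x = ∏ i, ∫ t : AddCircle (1:ℝ), fourier (k i) t := by
    rw [← integral_fintype_prod_volume_eq_prod (f := fun i t => (fourier (k i) t : ℂ))]
    rfl
  rw [this]
  exact prod_eq_zero (mem_univ i) (integral_fourier_ne _ hi)

open UnitAddTorus in
lemma converse (m d : ℕ) : ∃ c : ℕ, 1 ≤ c ∧ ∀ B : ℝ, 2 ≤ B → ∃ T₀ : ℕ, ∀ T : ℕ, T₀ ≤ T →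
    ∀ P : Fin m → ℝ[X], (∀ i, (P i).natDegree ≤ d) →
    ∀ k : Fin m → ℤ, k ≠ 0 → (∀ i, |(k i : ℝ)| ≤ B) → ∀ K : ℕ, 1 ≤ K → (K:ℝ) ≤ B →
      (∀ j, 1 ≤ j → j ≤ d → nn (K * (lcomb k P).coeff j) ≤ B / (T:ℝ) ^ j) →
    ¬ TotallyEquidistributed m T ((1 / B) ^ c) (polyU P) := by
  have hf1 : PB (fun B => 2 * (14 * (d + 1) * B)) :=
    (PB.const 2).mul ((PB.const _).mul PB.id)
  have hf2 : PB (fun B => 2 * (1 + 7 * m * (B * B)) + 1) :=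
    ((PB.const 2).mul ((PB.const 1).add ((PB.const _).mul (PB.id.mul PB.id)))).add (PB.const 1)
  obtain ⟨c, hc⟩ := hf1.le₂ hf2
  have hc1 : 1 ≤ c := by
    by_contra h
    have h0 : c = 0 := by omega
    subst h0
    have := (hc 2 le_rfl).2
    have hm : (0:ℝ) ≤ m := Nat.cast_nonneg _
    simp only [pow_zero] at this
    nlinarith
  refine ⟨c, hc1, fun B hB => ?_⟩
  obtain ⟨hb1, hb2⟩ := hc B hB
  have hB0 : 0 < B := by linarith
  set D : ℝ := 14 * (d + 1) * B with hD
  have hD0 : 0 < D := by positivity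
  have hD1 : 1 ≤ D := by
    have : (0:ℝ) ≤ d := Nat.cast_nonneg _
    rw [hD]; nlinarith
  refine ⟨⌈2 * D⌉₊, fun T hT P hP k hk hkB K hK1 hKB hnn hTE => ?_⟩
  have hT2 : 2 * D ≤ T := Nat.ceil_le.mp hT
  have hT0 : (0:ℝ) < T := by linarith
  set k' : Fin m → ℤ := fun i => (K:ℤ) * k i with hk'
  have hk'0 : k' ≠ 0 := by
    obtain ⟨i, hi⟩ := Function.ne_iff.mp hk
    refine Function.ne_iff.mpr ⟨i, ?_⟩
    simp only [hk', Pi.zero_apply] at hi ⊢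
    have : (K:ℤ) ≠ 0 := by omega
    exact mul_ne_zero this hi
  have hk'B : ∀ i, |(k' i : ℝ)| ≤ B * B := by
    intro i
    simp only [hk']
    push_cast
    rw [abs_mul, Nat.abs_cast]
    exact mul_le_mul hKB (hkB i) (abs_nonneg _) hB0.le
  set W := lcomb k' P with hW
  have hWd : W.natDegree ≤ d := lcomb_deg k' P hP
  have hWc : ∀ j, W.coeff j = K * (lcomb k P).coeff j := by
    intro j
    rw [hW, hk', lcomb_smul]; simp
  set ω : ℂ := ee (-(W.coeff 0)) with hω
  have hω1 : ‖ω‖ = 1 := norm_ee _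
  let F : Torus m → ℝ := fun x => (ω * mFourier k' x).re
  have hFS : ∀ x, |F x| ≤ 1 := fun x => by
    refine (Complex.abs_re_le_norm _).trans ?_
    rw [norm_mul, hω1, mFourier_norm_one, one_mul]
  have hFL : ∀ x y, |F x - F y| ≤ 7 * m * (B * B) * dist x y := fun x y => by
    have e : F x - F y = (ω * (mFourier k' x - mFourier k' y)).re := by
      simp only [F]; rw [mul_sub, Complex.sub_re]
    rw [e]
    refine (Complex.abs_re_le_norm _).trans ?_
    rw [norm_mul, hω1, one_mul]
    exact mFourier_lip k' x y _ hk'B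
  have hL0 : (0:ℝ) ≤ 7 * m * (B * B) := by positivity
  have hFlip : LipschitzWith (Real.toNNReal (7 * m * (B * B))) F :=
    LipschitzWith.of_dist_le_mul fun x y => by
      rw [Real.dist_eq, Real.coe_toNNReal _ hL0]; exact hFL x y
  have hΛ := lipNorm_le hFS hL0 hFL
  have hFint : ∫ x, F x = 0 := by
    have hi : Integrable (fun x : Torus m => ω * mFourier k' x) := cont_int (by fun_prop)
    have h1 : ∫ x, F x = (∫ x : Torus m, ω * mFourier k' x).re := by
      have := integral_re (𝕜 := ℂ) hi
      simpa [F] using this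
    rw [h1, integral_const_mul, integral_mFourier_ne k' hk'0]; simp
  set len := ⌊(T:ℝ) / D⌋₊ with hlen
  have hlen1 : (len:ℝ) ≤ T / D := Nat.floor_le (by positivity)
  have hlen2 : (T:ℝ) / D - 1 < len := Nat.sub_one_lt_floor _
  have hTD : 2 ≤ (T:ℝ) / D := by rw [le_div_iff₀ hD0]; exact hT2
  have hlenpos : 0 < len := by
    have : (0:ℝ) < len := by linarith
    exact_mod_cast this
  have hlenT : len ≤ T := by
    have : (len:ℝ) ≤ T := hlen1.trans (div_le_self hT0.le hD1)
    exact_mod_cast this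
  have hBc : (0:ℝ) < B ^ c := by positivity
  have hval : ∀ n ∈ range len, 1 / 2 ≤ F (polyU P (1 + n * 1)) := by
    intro n hn
    have hn' : n < len := by simpa using hn
    set y : ℕ := 1 + n * 1 with hy
    have hyl : y ≤ len := by omega
    have hyT : (y:ℝ) / T ≤ 1 / D := by
      rw [div_le_iff₀ hT0]
      have : (y:ℝ) ≤ len := by exact_mod_cast hyl
      calc (y:ℝ) ≤ T / D := this.trans hlen1
        _ = _ := by ring
    have hyT1 : (y:ℝ) / T ≤ 1 := hyT.trans (by rw [div_le_one hD0]; exact hD1)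
    have e1 : F (polyU P y) = (ee (W.eval (y:ℝ) - W.coeff 0)).re := by
      simp only [F]
      rw [mFourier_polyU, hω, ← ee_add]
      congr 2; ring
    have e2 : W.eval (y:ℝ) - W.coeff 0 = ∑ j ∈ range d, W.coeff (j + 1) * (y:ℝ) ^ (j + 1) := by
      rw [eval_eq_sum_range' (Nat.lt_succ_of_le hWd), sum_range_succ']
      simp
    have e3 : nn (W.eval (y:ℝ) - W.coeff 0) ≤ 1 / 14 := by
      rw [e2]
      refine (nn_sum_le _ _).trans ?_
      have : ∀ j ∈ range d, nn (W.coeff (j + 1) * (y:ℝ) ^ (j + 1)) ≤ B / D := by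
        intro j hj
        have hjd : j < d := by simpa using hj
        have h1 := hnn (j + 1) (by omega) (by omega)
        rw [← hWc] at h1
        have e : W.coeff (j + 1) * (y:ℝ) ^ (j + 1) = ((y ^ (j + 1) : ℕ):ℝ) * W.coeff (j + 1) := by
          push_cast; ring
        rw [e]
        refine (nn_nat_mul _ _).trans ?_
        calc ((y ^ (j + 1) : ℕ):ℝ) * nn (W.coeff (j + 1))
            ≤ ((y ^ (j + 1) : ℕ):ℝ) * (B / (T:ℝ) ^ (j + 1)) := by gcongr
          _ = B * ((y:ℝ) / T) ^ (j + 1) := by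
              rw [div_pow]; push_cast; ring
          _ ≤ B * ((y:ℝ) / T) := by
              gcongr
              exact pow_le_of_le_one (by positivity) hyT1 (by omega)
          _ ≤ B * (1 / D) := by gcongr
          _ = B / D := by ring
      refine (sum_le_sum this).trans ?_
      rw [sum_const, card_range, nsmul_eq_mul, mul_div_assoc', div_le_div_iff₀ hD0 (by norm_num), hD]
      nlinarith
    have e4 := norm_ee_sub_one_le (W.eval (y:ℝ) - W.coeff 0)
    have e5 := (Complex.abs_re_le_norm (ee (W.eval (y:ℝ) - W.coeff 0) - 1)).trans e4
    rw [Complex.sub_re, Complex.one_re] at e5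
    have e6 := (abs_le.mp e5).1
    rw [e1]
    linarith
  have hl0 : (0:ℝ) < len := by exact_mod_cast hlenpos
  have hsum : (len:ℝ) * (1 / 2) ≤ ∑ n ∈ range len, F (polyU P (1 + n * 1)) := by
    have := sum_le_sum hval
    rw [sum_const, card_range, nsmul_eq_mul] at this
    exact this
  have hmain := hTE 1 1 len one_pos hlenpos (fun n hn => ⟨by omega, by omega⟩) (by
    rw [div_pow, one_pow, div_mul_eq_mul_div, one_mul, div_le_iff₀ hBc]
    have h1 : (T:ℝ) / D / 2 ≤ len := by linarith
    calc (T:ℝ) = (T:ℝ) / D / 2 * (2 * D) := by field_simp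
      _ ≤ len * B ^ c := by gcongr) F _ hFlip
  rw [hFint, mul_zero, sub_zero] at hmain
  have h1 := hsum.trans ((le_abs_self _).trans hmain)
  have h2 : (1 / B) ^ c * lipNorm F < 1 / 2 := by
    rw [div_pow, one_pow, div_mul_eq_mul_div, one_mul, div_lt_iff₀ hBc]
    linarith
  nlinarith

lemma dilation_aux (m d : ℕ) : ∃ C' : ℕ, 1 ≤ C' ∧
      ∀ δ : ℝ, 0 < δ → δ < 1 →
        ∀ q : ℕ, 1 ≤ q →
          ∃ N₀ : ℕ, ∀ N : ℕ, N₀ ≤ N →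
            ∀ g : ℤ → Torus m, IsPolySeq m d g →
              ¬ TotallyEquidistributed m (N / q) δ (fun n : ℕ => g ((q : ℤ) * n)) →
              ∀ r : ℕ, r < q ^ d →
                ¬ TotallyEquidistributed m (N / q ^ d) (δ ^ C')
                    (fun n : ℕ => g ((q : ℤ) ^ d * n + r)) := by
  obtain ⟨c1, hc1⟩ := direct m d
  obtain ⟨c2, hc2, hconv⟩ := converse m d
  have hpb : PB (fun B => ((d + 1 : ℕ) : ℝ) * 4 ^ d * B ^ c1) :=
    ((PB.const _).mul (PB.const _)).mul (PB.id.pow c1)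
  obtain ⟨c3, hc3⟩ := hpb.le
  refine ⟨(c3 + 1) * c2, Nat.one_le_iff_ne_zero.mpr (by positivity), fun δ hδ0 hδ1 q hq => ?_⟩
  rcases le_or_gt (1 / 2) δ with hδ | hδ
  · exact ⟨0, fun N _ g _ hfail => absurd (tot_half _ _ _ _ hδ) hfail⟩
  set B := 1 / δ with hBdef
  have hB : 2 ≤ B := by
    rw [hBdef, le_div_iff₀ hδ0]; linarith
  have hBδ : 1 / B = δ := by rw [hBdef]; simp
  have hB0 : 0 < B := by linarith
  have hB' : 2 ≤ B ^ (c3 + 1) := hB.trans (le_self_pow₀ (by linarith) (by omega))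
  obtain ⟨M₀, hM₀⟩ := hc1 B hB
  obtain ⟨T₀, hT₀⟩ := hconv _ hB'
  refine ⟨q * M₀ + q ^ d * (T₀ + 1), fun N hN g hg hfail r hr => ?_⟩
  obtain ⟨P, hPd, hPg⟩ := hg
  have hqd : 0 < q ^ d := Nat.pow_pos (by omega)
  have hPn : ∀ i, (P i).natDegree ≤ d := fun i => natDegree_le_iff_degree_le.mpr (hPd i)
  have hM : M₀ ≤ N / q := (Nat.le_div_iff_mul_le (by omega)).mpr (by nlinarith)
  have hT : T₀ + 1 ≤ N / q ^ d := (Nat.le_div_iff_mul_le hqd).mpr (by nlinarith)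
  have e1 : (fun n : ℕ => g ((q : ℤ) * n)) = polyU (fun i => (P i).comp (C (q:ℝ) * X)) := by
    funext n i
    rw [hPg]
    simp [polyU]
  rw [e1, ← hBδ] at hfail
  obtain ⟨k, hk0, hkB, K, hK1, hKB, hnn⟩ := hM₀ _ hM _ (fun i => by
    simpa using natDegree_affine (P i) d (hPn i) 0 (q:ℝ)) hfail
  have e2 : (fun n : ℕ => g ((q : ℤ) ^ d * n + r))
      = polyU (fun i => (P i).comp (C ((q:ℝ) ^ d) * X + C (r:ℝ))) := by
    funext n i
    rw [hPg]
    simp only [polyU]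
    rw [eval_affine]
    push_cast; rfl
  rw [e2, pow_mul]
  have e3 : δ ^ (c3 + 1) = 1 / B ^ (c3 + 1) := by rw [← hBδ, div_pow, one_pow]
  rw [e3]
  rw [lcomb_comp] at hnn
  have hdil := dilate (lcomb k P) d (lcomb_deg k P hPn) q N r K hq hr (by omega) (B ^ c1)
    (by positivity) hnn
  have hbig : ((d + 1 : ℕ) : ℝ) * 4 ^ d * B ^ c1 ≤ B ^ (c3 + 1) :=
    (hc3 B hB).trans (pow_le_pow_right₀ (by linarith) (by omega))
  have hbig1 : B ^ c1 ≤ B ^ (c3 + 1) := by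
    refine le_trans (le_mul_of_one_le_left (by positivity) ?_) hbig
    have h1 : (1:ℝ) ≤ ((d + 1 : ℕ) : ℝ) := by exact_mod_cast Nat.succ_pos d
    exact one_le_mul_of_one_le_of_one_le h1 (one_le_pow₀ (by norm_num))
  refine hT₀ _ (by omega) _ (fun i => natDegree_affine (P i) d (hPn i) _ _) k hk0
    (fun i => (hkB i).trans hbig1) K hK1 (hKB.trans hbig1) (fun j hj1 hjd => ?_)
  rw [lcomb_comp]
  refine (hdil j hj1 hjd).trans ?_
  gcongr

end DilationHelpers

/-- **Dilation lemma on failure of total equidistribution** (torus case of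
[lmr, Lemma 16.3]): for all positive integers `m, d` there is `C' = C'(m,d) ≥ 1` such
that for every `δ ∈ (0,1)`, every integer `q ≥ 1` and every polynomial sequence
`g : ℤ → 𝕋^m` of degree `≤ d`, if `N` is sufficiently large in terms of `δ, q, m, d` and
`(g(q·n))_{n ≤ N/q}` fails to be totally `δ`-equidistributed, then for every `0 ≤ r < q^d`
the sequence `(g(q^d·n + r))_{n ≤ N/q^d}` fails to be totally `δ^{C'}`-equidistributed. -/
theorem torus_dilation_failure_of_equidistribution
    (m d : ℕ) (hm : 0 < m) (hd : 0 < d) :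
    ∃ C' : ℝ, 1 ≤ C' ∧
      ∀ δ : ℝ, 0 < δ → δ < 1 →
        ∀ q : ℕ, 1 ≤ q →
          ∃ N₀ : ℕ, ∀ N : ℕ, N₀ ≤ N →
            ∀ g : ℤ → Torus m, IsPolySeq m d g →
              ¬ TotallyEquidistributed m (N / q) δ (fun n : ℕ => g ((q : ℤ) * n)) →
              ∀ r : ℕ, r < q ^ d →
                ¬ TotallyEquidistributed m (N / q ^ d) (δ ^ C')
                    (fun n : ℕ => g ((q : ℤ) ^ d * n + r)) := by
  obtain ⟨c, hc, h⟩ := dilation_aux m d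
  refine ⟨(c : ℝ), by exact_mod_cast hc, ?_⟩
  simp_rw [Real.rpow_natCast]
  exact h
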